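/- arXiv:2502.11674 — 3 statements merged into one kernel-verified Lean document; each statement's English description precedes it below -/
import Mathlib

section
/- If a graph H is obtained from a graph G by subdividing one edge (replacing an edge xy by a path of new internal vertices), then the treebandwidth of H is at most the treebandwidth of G plus one. -/
open SimpleGraph

/-- `x` is a (reflexive) ancestor of `y` in the tree `T` rooted at `r`,
expressed metrically: `x` lies on the unique `r`–`y` path. -/
def AncIn {V : Type*} (T : SimpleGraph V) (r x y : V) : Prop :=
  T.dist r x + T.dist x y = T.dist r y

/-- A tree-layout of `G`: a rooted tree on the vertex set of `G` such that the endpoints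
of every edge of `G` are in ancestor-descendant relation. -/
structure TreeLayout {V : Type*} (G : SimpleGraph V) where
  tree : SimpleGraph V
  isTree : tree.IsTree
  root : V
  layout : ∀ ⦃x y : V⦄, G.Adj x y → AncIn tree root x y ∨ AncIn tree root y x

namespace TreeLayout

variable {V : Type*} {G : SimpleGraph V}

/-- `x` is an ancestor of `y` (reflexively) in the tree-layout. -/
def Anc (L : TreeLayout G) (x y : V) : Prop := AncIn L.tree L.root x y

def StrictAnc (L : TreeLayout G) (x y : V) : Prop := L.Anc x y ∧ x ≠ y

/-- The bandwidth of the tree-layout is at most `k`: neighbours in `G` are at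
tree-distance at most `k`. -/
def BandwidthLE (L : TreeLayout G) (k : ℕ) : Prop :=
  ∀ ⦃x y : V⦄, G.Adj x y → L.tree.dist x y ≤ k

/-- The interval `[a,b]` of the tree-layout: vertices on the tree path from `a` to `b`
(for `a` an ancestor of `b`). -/
def interval (L : TreeLayout G) (a b : V) : Set V := {z : V | L.Anc a z ∧ L.Anc z b}

end TreeLayout

/-- Treebandwidth: the minimum bandwidth over tree-layouts of `G`. -/
noncomputable def treebandwidth {V : Type*} (G : SimpleGraph V) : ℕ :=
  sInf {k | ∃ L : TreeLayout G, L.BandwidthLE k}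

/-- Treedepth: the minimum depth (number of vertices on a root-to-leaf path) of a
tree-layout (elimination tree) of `G`. -/
noncomputable def treedepth {V : Type*} (G : SimpleGraph V) : ℕ :=
  sInf {k | ∃ L : TreeLayout G, ∀ v : V, L.tree.dist L.root v + 1 ≤ k}

/-- A tree-partition of `G`: a partition of `V(G)` indexed by the nodes of a tree such that
every edge of `G` has both ends in one part or in parts indexed by adjacent nodes. -/
structure TreePartition {V : Type*} (G : SimpleGraph V) where
  ι : Type
  tree : SimpleGraph ι
  isTree : tree.IsTree
  part : V → ι
  adj : ∀ ⦃x y : V⦄, G.Adj x y → part x = part y ∨ tree.Adj (part x) (part y)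

/-- Tree-partition-width: minimum over tree-partitions of the maximum part size. -/
noncomputable def treePartitionWidth {V : Type*} (G : SimpleGraph V) : ℕ :=
  sInf {k | ∃ P : TreePartition G, ∀ i : P.ι, {v : V | P.part v = i}.ncard ≤ k}

/-- The connected component of `v` in the subgraph of `G` induced by `S`. -/
def connCompIn {V : Type*} (G : SimpleGraph V) (S : Set V) (v : V) : Set V :=
  {w : V | ∃ (hv : v ∈ S) (hw : w ∈ S), (G.induce S).Reachable ⟨v, hv⟩ ⟨w, hw⟩}

/-- `RootedTreedepthLE G U S n` expresses `td(G[S], U) ≤ n` for the rooted treedepth: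
it is `0` when `S` misses `U`, and otherwise one may delete one vertex from each
connected component and recurse. -/
inductive RootedTreedepthLE {V : Type*} (G : SimpleGraph V) (U : Set V) : Set V → ℕ → Prop
  | base (S : Set V) (n : ℕ) (h : S ∩ U = ∅) : RootedTreedepthLE G U S n
  | step (S : Set V) (n : ℕ) (pick : ∀ v : V, v ∈ S → V)
      (hpick : ∀ (v : V) (hv : v ∈ S), pick v hv ∈ connCompIn G S v)
      (h : ∀ (v : V) (hv : v ∈ S),
        RootedTreedepthLE G U (connCompIn G S v \ {pick v hv}) n) :
      RootedTreedepthLE G U S (n + 1)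

/-- A `U`-rooted minor model of the path on `k` vertices in `G`. -/
structure RootedPathMinor {V : Type*} (G : SimpleGraph V) (U : Set V) (k : ℕ) where
  branch : Fin k → Set V
  connected : ∀ i, (G.induce (branch i)).Connected
  disjoint : ∀ i j, i ≠ j → Disjoint (branch i) (branch j)
  rooted : ∀ i, (branch i ∩ U).Nonempty
  adj : ∀ i j : Fin k, (j : ℕ) = (i : ℕ) + 1 → ∃ a ∈ branch i, ∃ b ∈ branch j, G.Adj a b

/-- A subdivision of the `k`-fan in `G` with universal (center) vertex `v`:
branch vertices `b 0, …, b (k-1)` of the path, internally disjoint spokes from `v`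
and internally disjoint path segments between consecutive branch vertices. -/
structure FanSubdivision {V : Type*} (G : SimpleGraph V) (v : V) (k : ℕ) where
  b : Fin k → V
  binj : Function.Injective b
  bne : ∀ i, b i ≠ v
  spoke : ∀ i : Fin k, G.Walk v (b i)
  spokePath : ∀ i, (spoke i).IsPath
  seg : ∀ (i : Fin k) (h : (i : ℕ) + 1 < k), G.Walk (b i) (b ⟨(i : ℕ) + 1, h⟩)
  segPath : ∀ i h, (seg i h).IsPath
  vNotinSeg : ∀ i h, v ∉ (seg i h).support
  spokeDisj : ∀ i j, i ≠ j →
    {x | x ∈ (spoke i).support} ∩ {x | x ∈ (spoke j).support} = {v}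
  spokeSegDisj : ∀ i j h,
    {x | x ∈ (spoke i).support} ∩ {x | x ∈ (seg j h).support} ⊆
      ({b i} : Set V) ∩ {b j, b ⟨(j : ℕ) + 1, h⟩}
  segDisj : ∀ i j hi hj, i ≠ j →
    {x | x ∈ (seg i hi).support} ∩ {x | x ∈ (seg j hj).support} ⊆
      ({b i, b ⟨(i : ℕ) + 1, hi⟩} : Set V) ∩ {b j, b ⟨(j : ℕ) + 1, hj⟩}

/-- A `p`-centered colouring: every (nonempty) connected induced subgraph either receives
more than `p` colours or has a uniquely coloured vertex. -/
def IsPCenteredColoring {V : Type*} (G : SimpleGraph V) (p : ℕ) (c : V → ℕ) : Prop :=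
  ∀ S : Set V, S.Nonempty → (G.induce S).Connected →
    p < (c '' S).ncard ∨ ∃ x ∈ S, ∀ y ∈ S, c y = c x → y = x

/-- Treewidth, characterised via tree-layouts: the minimum over tree-layouts of the maximum
over nodes `u` of the number of strict ancestors of `u` that are `G`-neighbours of some
descendant of `u` (including `u`). -/
noncomputable def treewidthTL {V : Type*} (G : SimpleGraph V) : ℕ :=
  sInf {k | ∃ L : TreeLayout G, ∀ u : V,
    {a : V | L.StrictAnc a u ∧ ∃ d : V, L.Anc u d ∧ G.Adj a d}.ncard ≤ k}

/-- The pruned subtree of `x` in a tree-layout: descendants of `x` (including `x`) having a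
neighbour of `x` among their own descendants. -/
def prunedSubtree {V : Type*} {G : SimpleGraph V} (L : TreeLayout G) (x : V) : Set V :=
  {y : V | L.Anc x y ∧ ∃ d : V, L.Anc y d ∧ G.Adj x d}

/-- Treespan: the minimum over tree-layouts of (maximum size of a pruned subtree minus one). -/
noncomputable def treespan {V : Type*} (G : SimpleGraph V) : ℕ :=
  sInf {k | ∃ L : TreeLayout G, ∀ x : V, (prunedSubtree L x).ncard ≤ k + 1}

/-- A tree decomposition of `G`. -/
structure TreeDecomp {V : Type*} (G : SimpleGraph V) where
  ι : Type
  tree : SimpleGraph ι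
  isTree : tree.IsTree
  bag : ι → Set V
  coverV : ∀ v : V, ∃ t, v ∈ bag t
  coverE : ∀ ⦃x y : V⦄, G.Adj x y → ∃ t, x ∈ bag t ∧ y ∈ bag t
  subtree : ∀ v : V, (tree.induce {t : ι | v ∈ bag t}).Connected

/-- Domino treewidth: minimum width over tree decompositions in which every vertex
belongs to at most two bags. -/
noncomputable def dominoTreewidth {V : Type*} (G : SimpleGraph V) : ℕ :=
  sInf {k | ∃ D : TreeDecomp G, (∀ v : V, {t : D.ι | v ∈ D.bag t}.ncard ≤ 2) ∧
    ∀ t : D.ι, (D.bag t).ncard ≤ k + 1}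

/-- Edge-treewidth via tree-layouts: the minimum over tree-layouts of the maximum over nodes
`u` of the number of edges with one endpoint a descendant of `u` (including `u`) and the other
a strict ancestor of `u`. -/
noncomputable def edgeTreewidth {V : Type*} (G : SimpleGraph V) : ℕ :=
  sInf {k | ∃ L : TreeLayout G, ∀ u : V,
    {p : V × V | L.StrictAnc p.1 u ∧ L.Anc u p.2 ∧ G.Adj p.1 p.2}.ncard ≤ k}

/-- `S` is a block (2-connected component) of `G`: a maximal connected set of vertices whose
induced subgraph has no cutvertex. -/
def IsBlock {V : Type*} (G : SimpleGraph V) (S : Set V) : Prop :=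
  S.Nonempty ∧ (G.induce S).Connected ∧
    (∀ x ∈ S, (G.induce (S \ {x})).Preconnected) ∧
    ∀ S' : Set V, S ⊆ S' → (G.induce S').Connected →
      (∀ x ∈ S', (G.induce (S' \ {x})).Preconnected) → S' = S

/-- Biconnected maximum degree: the maximum over blocks of `G` of the maximum degree
inside the block. -/
noncomputable def biconnMaxDegree {V : Type*} (G : SimpleGraph V) : ℕ :=
  sSup {d | ∃ (S : Set V) (v : V), IsBlock G S ∧ v ∈ S ∧ d = {w ∈ S | G.Adj v w}.ncard}

/-- `G` is 3-connected: more than 3 vertices, and removing any two vertices leaves it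
connected. -/
def ThreeConnected {V : Type*} (G : SimpleGraph V) : Prop :=
  3 < Nat.card V ∧ ∀ x y : V, (G.induce {v : V | v ≠ x ∧ v ≠ y}).Connected

/-- `G` has `H` as a minor (branch-set model). -/
def HasMinor {V W : Type*} (G : SimpleGraph V) (H : SimpleGraph W) : Prop :=
  ∃ B : W → Set V, (∀ w, (G.induce (B w)).Connected) ∧
    (∀ w w', w ≠ w' → Disjoint (B w) (B w')) ∧
    ∀ ⦃w w'⦄, H.Adj w w' → ∃ a ∈ B w, ∃ b ∈ B w', G.Adj a b

/-- Planarity via Wagner's theorem: no `K₅` minor and no `K₃,₃` minor. -/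
def PlanarWagner {V : Type*} (G : SimpleGraph V) : Prop :=
  ¬ HasMinor G (completeGraph (Fin 5)) ∧
    ¬ HasMinor G (completeBipartiteGraph (Fin 3) (Fin 3))

/-- A subdivision of the `k`-wheel in `G` with hub `v`. -/
structure WheelSubdivision {V : Type*} (G : SimpleGraph V) (v : V) (k : ℕ) where
  b : Fin k → V
  binj : Function.Injective b
  bne : ∀ i, b i ≠ v
  spoke : ∀ i : Fin k, G.Walk v (b i)
  spokePath : ∀ i, (spoke i).IsPath
  seg : ∀ i : Fin k, G.Walk (b i) (b (finRotate k i))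
  segPath : ∀ i, (seg i).IsPath
  vNotinSeg : ∀ i, v ∉ (seg i).support
  spokeDisj : ∀ i j, i ≠ j →
    {x | x ∈ (spoke i).support} ∩ {x | x ∈ (spoke j).support} = {v}
  spokeSegDisj : ∀ i j,
    {x | x ∈ (spoke i).support} ∩ {x | x ∈ (seg j).support} ⊆
      ({b i} : Set V) ∩ {b j, b (finRotate k j)}
  segDisj : ∀ i j, i ≠ j →
    {x | x ∈ (seg i).support} ∩ {x | x ∈ (seg j).support} ⊆
      ({b i, b (finRotate k i)} : Set V) ∩ {b j, b (finRotate k j)}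

/-- A subdivision of the `k`-dipole with poles `u`, `v`: `k` internally vertex-disjoint
`u`–`v` paths of length at least `2`. -/
structure DipoleSubdivision {V : Type*} (G : SimpleGraph V) (u v : V) (k : ℕ) where
  path : Fin k → G.Walk u v
  isPath : ∀ i, (path i).IsPath
  len : ∀ i, 2 ≤ (path i).length
  disj : ∀ i j, i ≠ j →
    {x | x ∈ (path i).support} ∩ {x | x ∈ (path j).support} = ({u, v} : Set V)

/-- A separation of `G`. -/
def IsSeparation {V : Type*} (G : SimpleGraph V) (A B : Set V) : Prop :=
  A ∪ B = Set.univ ∧ ∀ a ∈ A \ B, ∀ b ∈ B \ A, ¬ G.Adj a b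

/-- `μ(X,Y)`: the minimum order of a separation `(A,B)` with `X ⊆ A` and `Y ⊆ B`. -/
noncomputable def muSep {V : Type*} (G : SimpleGraph V) (X Y : Set V) : ℕ :=
  sInf {n | ∃ A B : Set V, IsSeparation G A B ∧ X ⊆ A ∧ Y ⊆ B ∧ (A ∩ B).ncard = n}

def IsMaximalClique {V : Type*} (G : SimpleGraph V) (K : Set V) : Prop :=
  G.IsClique K ∧ ∀ K' : Set V, G.IsClique K' → K ⊆ K' → K' = K

/-- `G` is proper chordal: it has a tree-layout in which every maximal clique is an
interval of a root-to-leaf path. -/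
def ProperChordal {V : Type*} (G : SimpleGraph V) : Prop :=
  ∃ L : TreeLayout G, ∀ K : Set V, IsMaximalClique G K →
    ∃ a b : V, L.Anc a b ∧ K = L.interval a b

/-- A topological-minor model (subdivision embedding) of `H` in `G`. -/
structure TopMinorEmbedding {W V : Type*} (H : SimpleGraph W) (G : SimpleGraph V) where
  φ : W → V
  inj : Function.Injective φ
  path : ∀ ⦃a b : W⦄, H.Adj a b → G.Walk (φ a) (φ b)
  isPath : ∀ ⦃a b : W⦄ (h : H.Adj a b), (path h).IsPath
  branchOnPath : ∀ ⦃a b : W⦄ (h : H.Adj a b) (w : W),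
    φ w ∈ (path h).support → w = a ∨ w = b
  disj : ∀ ⦃a b c d : W⦄ (hab : H.Adj a b) (hcd : H.Adj c d), s(a, b) ≠ s(c, d) →
    {x | x ∈ (path hab).support} ∩ {x | x ∈ (path hcd).support} ⊆
      ({φ a, φ b} : Set V) ∩ {φ c, φ d}

/-- A subdivision of the star `K_{1,s}` in `H` with all leaves in `X`. -/
structure StarSubdivision {V : Type*} (H : SimpleGraph V) (X : Set V) (s : ℕ) where
  center : V
  leaf : Fin s → V
  leafInj : Function.Injective leaf
  leafX : ∀ i, leaf i ∈ X
  leafNe : ∀ i, leaf i ≠ center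
  path : ∀ i : Fin s, H.Walk center (leaf i)
  isPath : ∀ i, (path i).IsPath
  disj : ∀ i j, i ≠ j →
    {x | x ∈ (path i).support} ∩ {x | x ∈ (path j).support} = {center}

/-- The weight `w(t,U)` of a set `U` at a node `t` of a tree decomposition is at most `a`:
`|β(t) ∩ U|` plus the number of a suitable family of adhesions incident to `t` whose union
hits all paths from `β(t)` to `U ∖ β(t)` is at most `a`. -/
def WeightLE {V : Type*} {G : SimpleGraph V} (D : TreeDecomp G) (U : Set V) (t : D.ι)
    (a : ℕ) : Prop :=
  ∃ F : Set D.ι, (∀ s ∈ F, D.tree.Adj t s) ∧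
    (D.bag t ∩ U).ncard + F.ncard ≤ a ∧
    ∀ ⦃x y : V⦄ (p : G.Walk x y), x ∈ D.bag t → y ∈ U \ D.bag t →
      ∃ z ∈ p.support, ∃ s ∈ F, z ∈ D.bag t ∩ D.bag s

/-- The graph obtained from `G` by subdividing the edge `xy` into a path with `n + 1`
new internal vertices. -/
def subdivideEdge {V : Type*} (G : SimpleGraph V) (x y : V) (n : ℕ) :
    SimpleGraph (V ⊕ Fin (n + 1)) :=
  SimpleGraph.fromRel (fun a b =>
    (∃ u w : V, a = Sum.inl u ∧ b = Sum.inl w ∧ G.Adj u w ∧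
      ¬(u = x ∧ w = y) ∧ ¬(u = y ∧ w = x)) ∨
    (a = Sum.inl x ∧ b = Sum.inr 0) ∨
    (∃ i : Fin n, a = Sum.inr i.castSucc ∧ b = Sum.inr i.succ) ∨
    (a = Sum.inr (Fin.last n) ∧ b = Sum.inl y))

/-- A tree-layout of `G` of bandwidth at most `k`, presented by a parent function `p` that fixes
the root `r`: the endpoints of every edge are at most `k` parent steps apart. -/
def IsParentLayout {V : Type*} (G : SimpleGraph V) (k : ℕ) (r : V) (p : V → V) : Prop :=
  p r = r ∧ (∀ v, ∃ m, p^[m] v = r) ∧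
    ∀ ⦃u v⦄, G.Adj u v → ∃ j ≤ k, p^[j] u = v ∨ p^[j] v = u

section ParentFunction

variable {V : Type*} {r : V} {p : V → V}

/-- The tree in which every vertex is joined to its parent. -/
def parentGraph (p : V → V) : SimpleGraph V := SimpleGraph.fromRel fun a b => p a = b

lemma parentGraph_adj {a b : V} : (parentGraph p).Adj a b ↔ a ≠ b ∧ (p a = b ∨ p b = a) :=
  SimpleGraph.fromRel_adj _ _ _

lemma exists_depth (hr : p r = r) (h : ∀ v, ∃ m, p^[m] v = r) :
    ∃ d : V → ℕ, (∀ v, d v = 0 ↔ v = r) ∧ ∀ v, d (p v) = d v - 1 := by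
  classical
  refine ⟨fun v => Nat.find (h v), fun v => by simp, fun v => ?_⟩
  by_cases hv : v = r
  · subst hv
    have : Nat.find (h v) = 0 := by simp
    simp only [hr, this]
  · have h1 : Nat.find (h v) = Nat.find (h (p v)) + 1 :=
      Nat.find_comp_succ (h v) (h (p v)) (by simpa using hv)
    exact (Nat.sub_eq_of_eq_add h1).symm

lemma depth_iterate {d : V → ℕ} (hd : ∀ v, d (p v) = d v - 1) (j : ℕ) (v : V) :
    d (p^[j] v) = d v - j := by
  induction j generalizing v with
  | zero => rfl
  | succ j ih => rw [Function.iterate_succ_apply, ih, hd]; omega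

lemma exists_walk_parentGraph (v : V) (j : ℕ) :
    ∃ w : (parentGraph p).Walk v (p^[j] v), w.length ≤ j := by
  induction j generalizing v with
  | zero => exact ⟨.nil, le_rfl⟩
  | succ j ih =>
    rw [Function.iterate_succ_apply]
    by_cases hv : v = p v
    · obtain ⟨w, hw⟩ := ih v
      rw [← hv]
      exact ⟨w, by omega⟩
    · obtain ⟨w, hw⟩ := ih (p v)
      exact ⟨.cons (parentGraph_adj.2 ⟨hv, .inl rfl⟩) w, by simpa using hw⟩

lemma dist_iterate_le (v : V) (j : ℕ) : (parentGraph p).dist v (p^[j] v) ≤ j := by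
  obtain ⟨w, hw⟩ := exists_walk_parentGraph (p := p) v j
  exact (SimpleGraph.dist_le w).trans hw

lemma parentGraph_connected (h : ∀ v, ∃ m, p^[m] v = r) : (parentGraph p).Connected := by
  have hreach : ∀ v, (parentGraph p).Reachable v r := fun v => by
    obtain ⟨m, rfl⟩ := h v
    exact (exists_walk_parentGraph v m).choose.reachable
  exact { preconnected := fun u v => (hreach u).trans (hreach v).symm, nonempty := ⟨r⟩ }

lemma parentGraph_isBridge {d : V → ℕ} (hd0 : ∀ v, d v = 0 ↔ v = r)
    (hd : ∀ v, d (p v) = d v - 1) {v : V} (hv : v ≠ p v) :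
    (parentGraph p).IsBridge s(v, p v) := by
  rw [SimpleGraph.isBridge_iff]
  rintro ⟨w⟩
  have key : ∀ a b, ((parentGraph p).deleteEdges {s(v, p v)}).Walk a b →
      (∃ j, p^[j] a = v) → ∃ j, p^[j] b = v := by
    intro a b w
    induction w with
    | nil => exact id
    | @cons a b c hab _ ih =>
      rintro ⟨j, hj⟩
      apply ih
      rw [SimpleGraph.deleteEdges_adj, parentGraph_adj] at hab
      obtain ⟨⟨-, rfl | rfl⟩, hne⟩ := hab
      · cases j with
        | zero => exact absurd (by rw [← hj]; rfl) hne
        | succ j => exact ⟨j, hj⟩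
      · exact ⟨j + 1, hj⟩
  obtain ⟨j, hj⟩ := key _ _ w ⟨0, rfl⟩
  have h1 := depth_iterate hd j (p v)
  rw [hj, hd] at h1
  have h0 : d v = 0 := by omega
  have h2 : d (p v) = 0 := by rw [hd, h0]
  exact hv (((hd0 _).1 h0).trans ((hd0 _).1 h2).symm)

lemma parentGraph_isTree (hr : p r = r) (h : ∀ v, ∃ m, p^[m] v = r) :
    (parentGraph p).IsTree := by
  obtain ⟨d, hd0, hd⟩ := exists_depth hr h
  refine (SimpleGraph.isTree_iff _).2 ⟨parentGraph_connected h,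
    SimpleGraph.isAcyclic_iff_forall_adj_isBridge.2 fun v w hvw => ?_⟩
  rw [parentGraph_adj] at hvw
  obtain ⟨hne, rfl | rfl⟩ := hvw
  · exact parentGraph_isBridge hd0 hd hne
  · rw [Sym2.eq_swap]
    exact parentGraph_isBridge hd0 hd hne.symm

lemma dist_root_parentGraph (h : ∀ v, ∃ m, p^[m] v = r) {d : V → ℕ}
    (hd0 : ∀ v, d v = 0 ↔ v = r) (hd : ∀ v, d (p v) = d v - 1) (v : V) :
    (parentGraph p).dist r v = d v := by
  apply le_antisymm
  · have h0 : p^[d v] v = r := (hd0 _).1 (by rw [depth_iterate hd, Nat.sub_self])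
    have := dist_iterate_le (p := p) v (d v)
    rwa [h0, SimpleGraph.dist_comm] at this
  · obtain ⟨w, hw⟩ := (parentGraph_connected h).exists_walk_length_eq_dist v r
    rw [SimpleGraph.dist_comm, ← hw]
    have key : ∀ a b, ∀ w : (parentGraph p).Walk a b, d a ≤ d b + w.length := by
      intro a b w
      induction w with
      | nil => simp
      | @cons a b c hab _ ih =>
        rw [parentGraph_adj] at hab
        rw [SimpleGraph.Walk.length_cons]
        obtain ⟨-, rfl | rfl⟩ := hab
        · have := hd a
          omega
        · have := hd b
          omega
    simpa [(hd0 r).2 rfl] using key _ _ w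

lemma ancIn_parentGraph_iterate (hr : p r = r) (h : ∀ v, ∃ m, p^[m] v = r) (v : V) (j : ℕ) :
    AncIn (parentGraph p) r (p^[j] v) v := by
  obtain ⟨d, hd0, hd⟩ := exists_depth hr h
  have hroot := dist_root_parentGraph h hd0 hd
  have hdj := depth_iterate hd j v
  unfold AncIn
  rcases le_total j (d v) with hj | hj
  · have h1 := (parentGraph_connected h).dist_triangle (u := r) (v := p^[j] v) (w := v)
    have h2 := dist_iterate_le (p := p) v j
    rw [SimpleGraph.dist_comm] at h2
    rw [hroot, hroot] at h1 ⊢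
    omega
  · have h0 : p^[j] v = r := (hd0 _).1 (by omega)
    rw [h0, SimpleGraph.dist_self, Nat.zero_add]

lemma IsParentLayout.exists_treeLayout {G : SimpleGraph V} {k : ℕ}
    (h : IsParentLayout G k r p) : ∃ L : TreeLayout G, L.BandwidthLE k := by
  obtain ⟨hr, hreach, hG⟩ := h
  refine ⟨⟨parentGraph p, parentGraph_isTree hr hreach, r, fun u v huv => ?_⟩, fun u v huv => ?_⟩
  · obtain ⟨j, -, rfl | rfl⟩ := hG huv
    · exact .inr (ancIn_parentGraph_iterate hr hreach u j)
    · exact .inl (ancIn_parentGraph_iterate hr hreach v j)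
  · obtain ⟨j, hj, rfl | rfl⟩ := hG huv
    · exact (dist_iterate_le u j).trans hj
    · exact SimpleGraph.dist_comm.trans_le ((dist_iterate_le v j).trans hj)

end ParentFunction

section OfTreeLayout

variable {V : Type*} {T : SimpleGraph V}

lemma SimpleGraph.Connected.exists_adj_dist_add_one (hT : T.Connected) {u v : V} (h : u ≠ v) :
    ∃ w, T.Adj w v ∧ T.dist u w + 1 = T.dist u v := by
  obtain ⟨q, hq⟩ := hT.exists_walk_length_eq_dist v u
  cases q with
  | nil => exact absurd rfl h
  | @cons _ w _ hvw q =>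
    refine ⟨w, hvw.symm, ?_⟩
    rw [SimpleGraph.Walk.length_cons, T.dist_comm] at hq
    have h1 := T.dist_le q
    have h2 := hT.dist_triangle (u := u) (v := w) (w := v)
    rw [SimpleGraph.dist_eq_one_iff_adj.2 hvw.symm] at h2
    rw [T.dist_comm] at h1
    omega

lemma SimpleGraph.IsTree.adj_dist_add_one_unique (hT : T.IsTree) {u v w w' : V}
    (hw : T.Adj w v) (hd : T.dist u w + 1 = T.dist u v)
    (hw' : T.Adj w' v) (hd' : T.dist u w' + 1 = T.dist u v) : w = w' := by
  have key : ∀ {z}, T.Adj z v → T.dist u z + 1 = T.dist u v →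
      ∃ q : T.Walk v u, q.IsPath ∧ q.snd = z := by
    intro z hz hd
    obtain ⟨q, hq⟩ := hT.connected.exists_walk_length_eq_dist z u
    refine ⟨.cons hz.symm q, SimpleGraph.Walk.isPath_of_length_eq_dist _ ?_, by simp⟩
    rw [SimpleGraph.Walk.length_cons, hq, T.dist_comm, hd, T.dist_comm]
  obtain ⟨q, hq, rfl⟩ := key hw hd
  obtain ⟨q', hq', rfl⟩ := key hw' hd'
  rw [(hT.existsUnique_path v u).unique hq hq']

lemma TreeLayout.exists_isParentLayout {G : SimpleGraph V} {k : ℕ} (L : TreeLayout G)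
    (hL : L.BandwidthLE k) : ∃ r p, IsParentLayout G k r p := by
  have hconn := L.isTree.connected
  have hex : ∀ v, ∃ w, (v = L.root → w = L.root) ∧ (v ≠ L.root → L.tree.Adj w v ∧
      L.tree.dist L.root w + 1 = L.tree.dist L.root v) := by
    intro v
    by_cases hv : v = L.root
    · exact ⟨L.root, fun _ => rfl, fun h => absurd hv h⟩
    · obtain ⟨w, hw⟩ := hconn.exists_adj_dist_add_one (Ne.symm hv)
      exact ⟨w, fun h => absurd h hv, fun _ => hw⟩
  choose p hpr hp using hex
  have hanc : ∀ m x y, AncIn L.tree L.root x y → L.tree.dist x y = m → p^[m] y = x := by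
    intro m
    induction m with
    | zero =>
      intro x y _ h
      exact (hconn.dist_eq_zero_iff.1 h).symm
    | succ m ih =>
      intro x y hxy h
      have hne : x ≠ y := by rintro rfl; simp at h
      obtain ⟨z, hz, hzd⟩ := hconn.exists_adj_dist_add_one hne
      have h1 := hconn.dist_triangle (u := L.root) (v := x) (w := z)
      have h2 := hconn.dist_triangle (u := L.root) (v := z) (w := y)
      rw [SimpleGraph.dist_eq_one_iff_adj.2 hz] at h2
      unfold AncIn at hxy
      have hy : y ≠ L.root := by
        rintro rfl
        rw [SimpleGraph.dist_self] at hxy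
        omega
      have hzy : p y = z :=
        L.isTree.adj_dist_add_one_unique (hp y hy).1 (hp y hy).2 hz (by omega)
      rw [Function.iterate_succ_apply, hzy]
      exact ih x z (by unfold AncIn; omega) (by omega)
  refine ⟨L.root, p, hpr _ rfl, fun v => ⟨_, hanc _ _ v (by simp [AncIn]) rfl⟩, fun u v huv => ?_⟩
  rcases L.layout huv with h | h
  · exact ⟨_, hL huv, .inr (hanc _ _ _ h rfl)⟩
  · exact ⟨_, hL huv.symm, .inl (hanc _ _ _ h rfl)⟩

end OfTreeLayout

section Subdivide

variable {V : Type*} {G : SimpleGraph V} {x y r : V} {p : V → V} {k n : ℕ}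

lemma IsParentLayout.of_equiv {W : Type*} {H : SimpleGraph W} (h : IsParentLayout G k r p)
    (e : V ≃ W) (hadj : ∀ ⦃a b⦄, H.Adj a b → G.Adj (e.symm a) (e.symm b)) :
    IsParentLayout H k (e r) (fun w => e (p (e.symm w))) := by
  have hit : ∀ j w, (fun w => e (p (e.symm w)))^[j] w = e (p^[j] (e.symm w)) := by
    intro j
    induction j with
    | zero => simp
    | succ j ih => intro w; simp only [Function.iterate_succ_apply, ih, Equiv.symm_apply_apply]
  obtain ⟨hr, hreach, hG⟩ := h
  refine ⟨by simp [hr], fun w => ?_, fun a b hab => ?_⟩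
  · obtain ⟨m, hm⟩ := hreach (e.symm w)
    exact ⟨m, by rw [hit, hm]⟩
  · obtain ⟨j, hj, h⟩ := hG (hadj hab)
    exact ⟨j, hj, by simpa only [hit, ← Equiv.eq_symm_apply] using h⟩

lemma subdivideEdge_adj_inl {u w : V} (h : G.Adj u w) (hxy : ¬(u = x ∧ w = y))
    (hyx : ¬(u = y ∧ w = x)) : (subdivideEdge G x y n).Adj (.inl u) (.inl w) := by
  rw [subdivideEdge, SimpleGraph.fromRel_adj]
  exact ⟨Sum.inl_injective.ne h.ne, .inl (.inl ⟨u, w, rfl, rfl, h, hxy, hyx⟩)⟩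

lemma subdivideEdge_adj_first : (subdivideEdge G x y n).Adj (.inl x) (.inr 0) := by
  simp [subdivideEdge]

lemma subdivideEdge_adj_consecutive (i : Fin n) :
    (subdivideEdge G x y n).Adj (.inr i.castSucc) (.inr i.succ) := by
  rw [subdivideEdge, SimpleGraph.fromRel_adj]
  exact ⟨Sum.inr_injective.ne i.castSucc_lt_succ.ne, .inl (.inr (.inr (.inl ⟨i, rfl, rfl⟩)))⟩

lemma subdivideEdge_adj_last : (subdivideEdge G x y n).Adj (.inr (Fin.last n)) (.inl y) := by
  simp [subdivideEdge]

lemma subdivideEdge_adj_induction {P : V ⊕ Fin (n + 1) → V ⊕ Fin (n + 1) → Prop}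
    (symm : ∀ a b, P a b → P b a)
    (old : ∀ u w, G.Adj u w → ¬(u = x ∧ w = y) → ¬(u = y ∧ w = x) → P (.inl u) (.inl w))
    (first : P (.inl x) (.inr 0)) (consecutive : ∀ i : Fin n, P (.inr i.castSucc) (.inr i.succ))
    (last : P (.inr (Fin.last n)) (.inl y)) ⦃a b : V ⊕ Fin (n + 1)⦄
    (h : (subdivideEdge G x y n).Adj a b) : P a b := by
  rw [subdivideEdge, SimpleGraph.fromRel_adj] at h
  rcases h.2 with h | h
  · rcases h with ⟨u, w, rfl, rfl, h1, h2, h3⟩ | ⟨rfl, rfl⟩ | ⟨i, rfl, rfl⟩ | ⟨rfl, rfl⟩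
    exacts [old u w h1 h2 h3, first, consecutive i, last]
  · apply symm
    rcases h with ⟨u, w, rfl, rfl, h1, h2, h3⟩ | ⟨rfl, rfl⟩ | ⟨i, rfl, rfl⟩ | ⟨rfl, rfl⟩
    exacts [old u w h1 h2 h3, first, consecutive i, last]

lemma subdivideEdge_adj_rev ⦃a b : V ⊕ Fin (n + 1)⦄ (h : (subdivideEdge G x y n).Adj a b) :
    (subdivideEdge G y x n).Adj (Equiv.sumCongr (.refl V) Fin.revPerm a)
      (Equiv.sumCongr (.refl V) Fin.revPerm b) := by
  refine subdivideEdge_adj_induction (P := fun a b => (subdivideEdge G y x n).Adj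
    (Equiv.sumCongr (.refl V) Fin.revPerm a) (Equiv.sumCongr (.refl V) Fin.revPerm b))
    (fun a b h => h.symm) (fun u w h h1 h2 => subdivideEdge_adj_inl h h2 h1) ?_ (fun i => ?_) ?_ h
  · simpa using subdivideEdge_adj_last.symm
  · simpa [Fin.rev_castSucc, Fin.rev_succ] using (subdivideEdge_adj_consecutive i.rev).symm
  · simpa using subdivideEdge_adj_first.symm

/-- Extension of a parent function to the subdivision vertices: below `y` they form the path
`0, n, 1, n - 1, 2, …`. -/
def zigzagParent (p : V → V) (y : V) (n : ℕ) : V ⊕ Fin (n + 1) → V ⊕ Fin (n + 1)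
  | .inl v => .inl (p v)
  | .inr i =>
    if h : (i : ℕ) = 0 then .inl y
    else if 2 * (i : ℕ) ≤ n then .inr ⟨n + 1 - i, by omega⟩
    else .inr ⟨n - i, by omega⟩

lemma zigzagParent_iterate_inl (v : V) (j : ℕ) :
    (zigzagParent p y n)^[j] (.inl v) = .inl (p^[j] v) := by
  induction j generalizing v with
  | zero => rfl
  | succ j ih => simp only [Function.iterate_succ_apply, zigzagParent, ih]

lemma zigzagParent_zero : zigzagParent p y n (.inr 0) = .inl y := by simp [zigzagParent]

lemma zigzagParent_of_two_mul_le {i : ℕ} (h0 : 0 < i) (hi : 2 * i ≤ n) :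
    zigzagParent p y n (.inr ⟨i, by omega⟩) = .inr ⟨n + 1 - i, by omega⟩ := by
  simp [zigzagParent, h0.ne', hi]

lemma zigzagParent_of_lt_two_mul {i : ℕ} (hn : i < n + 1) (hi : n < 2 * i) :
    zigzagParent p y n (.inr ⟨i, hn⟩) = .inr ⟨n - i, by omega⟩ := by
  have h0 : i ≠ 0 := by omega
  simp [zigzagParent, h0, hi.not_ge]

lemma zigzagParent_iterate_inr (i : ℕ) (hi : i < n + 1) :
    ∃ m, (zigzagParent p y n)^[m] (.inr ⟨i, hi⟩) = .inl y := by
  induction hs : (if 2 * i ≤ n then 2 * i else 2 * (n - i) + 1) using Nat.strong_induction_on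
    generalizing i with
  | _ s ih =>
    rcases Nat.eq_zero_or_pos i with rfl | h0
    · exact ⟨1, zigzagParent_zero (p := p)⟩
    · by_cases h : 2 * i ≤ n
      · obtain ⟨m, hm⟩ := ih _ (by split_ifs at hs ⊢ <;> omega) (n + 1 - i) (by omega) rfl
        exact ⟨m + 1, by rw [Function.iterate_succ_apply, zigzagParent_of_two_mul_le h0 h, hm]⟩
      · obtain ⟨m, hm⟩ := ih _ (by split_ifs at hs ⊢ <;> omega) (n - i) (by omega) rfl
        exact ⟨m + 1, by
          rw [Function.iterate_succ_apply, zigzagParent_of_lt_two_mul hi (by omega), hm]⟩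

lemma zigzagParent_consecutive (i : Fin n) :
    ∃ j ≤ 2, (zigzagParent p y n)^[j] (.inr i.castSucc) = .inr i.succ ∨
      (zigzagParent p y n)^[j] (.inr i.succ) = .inr i.castSucc := by
  obtain ⟨i, hi⟩ := i
  simp only [Fin.castSucc_mk, Fin.succ_mk]
  rcases lt_trichotomy (2 * i + 1) n with h | h | h
  · refine ⟨2, le_rfl, .inr ?_⟩
    simp only [Function.iterate_succ_apply, Function.iterate_zero_apply]
    rw [zigzagParent_of_two_mul_le (by omega) (by omega),
      zigzagParent_of_lt_two_mul _ (by omega)]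
    congr 2
    omega
  · refine ⟨1, by omega, .inr ?_⟩
    rw [Function.iterate_one, zigzagParent_of_lt_two_mul _ (by omega)]
    congr 2
    omega
  · rcases eq_or_lt_of_le (Nat.le_of_lt_succ h) with h | h
    · refine ⟨1, by omega, .inl ?_⟩
      rw [Function.iterate_one, zigzagParent_of_two_mul_le (by omega) (by omega)]
      congr 2
      omega
    · refine ⟨2, le_rfl, .inl ?_⟩
      simp only [Function.iterate_succ_apply, Function.iterate_zero_apply]
      rw [zigzagParent_of_lt_two_mul _ (by omega),
        zigzagParent_of_two_mul_le (by omega) (by omega)]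
      congr 2
      omega

lemma zigzagParent_last : ∃ j ≤ 2, (zigzagParent p y n)^[j] (.inr (Fin.last n)) = .inl y := by
  rcases Nat.eq_zero_or_pos n with rfl | h
  · exact ⟨1, by omega, zigzagParent_zero (p := p)⟩
  · refine ⟨2, le_rfl, ?_⟩
    simp only [Function.iterate_succ_apply, Function.iterate_zero_apply, Fin.last]
    rw [zigzagParent_of_lt_two_mul _ (by omega)]
    simp [zigzagParent]

/-- The new vertices can be hung as a pendant path below the lower endpoint `y`. -/
lemma IsParentLayout.subdivideEdge_of_iterate_eq (h : IsParentLayout G k r p) (hne : x ≠ y)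
    {j : ℕ} (hj : j ≤ k) (hyx : p^[j] y = x) :
    IsParentLayout (subdivideEdge G x y n) (k + 1) (.inl r) (zigzagParent p y n) := by
  obtain ⟨hr, hreach, hG⟩ := h
  have hk : 1 ≤ k := by
    rcases Nat.eq_zero_or_pos j with rfl | h0
    · exact absurd hyx.symm hne
    · omega
  refine ⟨congrArg Sum.inl hr, ?_, ?_⟩
  · rintro (v | i)
    · obtain ⟨m, hm⟩ := hreach v
      exact ⟨m, by rw [zigzagParent_iterate_inl, hm]⟩
    · obtain ⟨m, hm⟩ := hreach y
      obtain ⟨l, hl⟩ := zigzagParent_iterate_inr (p := p) (y := y) (i : ℕ) i.2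
      exact ⟨m + l, by rw [Function.iterate_add_apply, hl, zigzagParent_iterate_inl, hm]⟩
  · refine subdivideEdge_adj_induction ?_ (fun u w h _ _ => ?_) ?_ (fun i => ?_) ?_
    · rintro a b ⟨i, hi, h⟩
      exact ⟨i, hi, h.symm⟩
    · obtain ⟨i, hi, h⟩ := hG h
      exact ⟨i, by omega, by simpa only [zigzagParent_iterate_inl, Sum.inl.injEq] using h⟩
    · refine ⟨j + 1, by omega, .inr ?_⟩
      rw [Function.iterate_succ_apply, zigzagParent_zero, zigzagParent_iterate_inl, hyx]
    · obtain ⟨l, hl, h⟩ := zigzagParent_consecutive (p := p) (y := y) i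
      exact ⟨l, by omega, h⟩
    · obtain ⟨l, hl, h⟩ := zigzagParent_last (p := p) (y := y) (n := n)
      exact ⟨l, by omega, .inl h⟩

lemma IsParentLayout.exists_subdivideEdge (h : IsParentLayout G k r p) (hxy : G.Adj x y) (n : ℕ) :
    ∃ r' p', IsParentLayout (subdivideEdge G x y n) (k + 1) r' p' := by
  obtain ⟨j, hj, hxy' | hyx⟩ := h.2.2 hxy
  · exact ⟨_, _, (h.subdivideEdge_of_iterate_eq (n := n) hxy.ne' hj hxy').of_equiv
      (Equiv.sumCongr (.refl V) Fin.revPerm).symm subdivideEdge_adj_rev⟩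
  · exact ⟨_, _, h.subdivideEdge_of_iterate_eq hxy.ne hj hyx⟩

end Subdivide

section Unsubdivide

variable {V : Type*}

lemma Set.Finite.exists_enumeration {F : Set V} (hF : F.Finite) (hne : F.Nonempty) :
    ∃ (N : ℕ) (c : ℕ → V) (idx : V → ℕ), (∀ v ∈ F, idx v ≤ N ∧ c (idx v) = v) ∧
      ∀ i ≤ N, c i ∈ F ∧ idx (c i) = i := by
  classical
  obtain ⟨v₀, hv₀⟩ := hne
  obtain ⟨m, ⟨e⟩⟩ := @Finite.exists_equiv_fin F hF
  have hm : 0 < m := (e ⟨v₀, hv₀⟩).pos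
  refine ⟨m - 1, fun i => if h : i < m then e.symm ⟨i, h⟩ else v₀,
    fun v => if h : v ∈ F then e ⟨v, h⟩ else 0, fun v hv => ?_, fun i hi => ?_⟩
  · have := (e ⟨v, hv⟩).2
    simp only [hv, dite_true, Fin.is_lt, Fin.eta, Equiv.symm_apply_apply, and_true]
    omega
  · have h : i < m := by omega
    simp [h]

/-- A layout of a graph `H` on `V ⊕ W` with `W` finite yields a layout of every graph on `V` whose
edges, apart from those inside a finite set `S`, are edges of `H`: all ancestors of `S` and `W`
are rearranged into one path at the top of the tree. -/
lemma IsParentLayout.exists_of_finite_modification {W : Type*} [Finite W] {G : SimpleGraph V}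
    {H : SimpleGraph (V ⊕ W)} {k : ℕ} {r : V ⊕ W} {p : V ⊕ W → V ⊕ W}
    (h : IsParentLayout H k r p) {S : Set V} (hS : S.Finite) (hne : S.Nonempty)
    (hadj : ∀ ⦃u v⦄, G.Adj u v → H.Adj (.inl u) (.inl v) ∨ u ∈ S ∧ v ∈ S) :
    ∃ k' r' p', IsParentLayout G k' r' p' := by
  classical
  obtain ⟨hr, hreach, hH⟩ := h
  set A : Set (V ⊕ W) := ⋃ t ∈ Sum.inl '' S ∪ Set.range Sum.inr, Set.range fun j => p^[j] t with hA
  have hAfin : A.Finite := by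
    refine ((hS.image _).union (Set.finite_range _)).biUnion fun t _ => ?_
    obtain ⟨m, hm⟩ := hreach t
    refine ((Set.finite_Iic m).image fun j => p^[j] t).subset ?_
    rintro _ ⟨j, rfl⟩
    rcases le_total j m with hj | hj
    · exact ⟨j, hj, rfl⟩
    · refine ⟨m, Set.self_mem_Iic, ?_⟩
      obtain ⟨i, rfl⟩ := Nat.exists_eq_add_of_le' hj
      simp only [Function.iterate_add_apply, hm, Function.iterate_fixed hr]
  have hAS : ∀ v ∈ S, Sum.inl v ∈ A := fun v hv =>
    Set.mem_biUnion (.inl ⟨v, hv, rfl⟩) ⟨0, rfl⟩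
  have hAW : ∀ w, Sum.inr w ∈ A := fun w => Set.mem_biUnion (.inr ⟨w, rfl⟩) ⟨0, rfl⟩
  have hAp : ∀ j, ∀ a ∈ A, p^[j] a ∈ A := by
    intro j a ha
    simp only [hA, Set.mem_iUnion] at ha
    obtain ⟨t, ht, i, rfl⟩ := ha
    exact Set.mem_biUnion ht ⟨j + i, Function.iterate_add_apply ..⟩
  set F : Set V := Sum.inl ⁻¹' A
  obtain ⟨v₀, hv₀⟩ := hne
  obtain ⟨N, c, idx, hidx, hc⟩ :=
    (hAfin.preimage Sum.inl_injective.injOn : F.Finite).exists_enumeration ⟨v₀, hAS v₀ hv₀⟩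
  set q : V → V := fun v => if v ∈ F then c (idx v - 1) else
    Sum.elim (fun u => if u ∈ F then c N else u) (fun _ => c N) (p (.inl v)) with hq
  have hqc : ∀ j i, i ≤ N → q^[j] (c i) = c (i - j) := by
    intro j
    induction j with
    | zero => simp
    | succ j ih =>
      intro i hi
      have : q (c i) = c (i - 1) := (if_pos (hc i hi).1).trans (by rw [(hc i hi).2])
      rw [Function.iterate_succ_apply, this, ih _ (by omega)]
      congr 1
      omega
  have hqp : ∀ v ∉ F, (∃ u ∉ F, p (.inl v) = .inl u ∧ q v = u) ∨
      p (.inl v) ∈ A ∧ q v = c N := by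
    intro v hv
    simp only [hq, hv, if_false]
    rcases hpv : p (.inl v) with u | w
    · by_cases hu : u ∈ F
      · exact .inr ⟨hu, by simp [hu]⟩
      · exact .inl ⟨u, hu, rfl, by simp [hu]⟩
    · exact .inr ⟨hAW w, rfl⟩
  have hqF : ∀ m, ∀ v ∉ F, p^[m] (.inl v) ∈ A → ∀ f ∈ F, ∃ j ≤ m + N, q^[j] v = f := by
    intro m
    induction m with
    | zero => exact fun v hv h => absurd h hv
    | succ m ih =>
      intro v hv hm f hf
      rcases hqp v hv with ⟨u, hu, hpu, hqu⟩ | ⟨-, hqv⟩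
      · rw [Function.iterate_succ_apply, hpu] at hm
        obtain ⟨j, hj, hjf⟩ := ih u hu hm f hf
        exact ⟨j + 1, by omega, by rw [Function.iterate_succ_apply, hqu, hjf]⟩
      · obtain ⟨hfN, hcf⟩ := hidx f hf
        refine ⟨N - idx f + 1, by omega, ?_⟩
        rw [Function.iterate_succ_apply, hqv, hqc _ _ le_rfl, Nat.sub_sub_self hfN, hcf]
  have hqout : ∀ j, ∀ v ∉ F, ∀ u ∉ F, p^[j] (.inl v) = .inl u → q^[j] v = u := by
    intro j
    induction j with
    | zero => exact fun v _ u _ h => Sum.inl_injective h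
    | succ j ih =>
      intro v hv u hu h
      rw [Function.iterate_succ_apply] at h ⊢
      rcases hqp v hv with ⟨u', hu', hpu, hqu⟩ | ⟨hpA, -⟩
      · rw [hqu]
        exact ih u' hu' u hu (hpu ▸ h)
      · exact (hu (show _ ∈ A from h ▸ hAp j _ hpA)).elim
  have hqin : ∀ u ∈ F, ∀ v ∈ F, idx u ≤ idx v → ∃ j ≤ N, q^[j] v = u := by
    intro u hu v hv huv
    obtain ⟨hvN, hcv⟩ := hidx v hv
    refine ⟨idx v - idx u, by omega, ?_⟩
    rw [← hcv, hqc _ _ hvN, hcv, Nat.sub_sub_self huv, (hidx u hu).2]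
  have h0 := hc 0 (Nat.zero_le N)
  refine ⟨k + N, c 0, q, hqc 1 0 (Nat.zero_le N), fun v => ?_, fun u v huv => ?_⟩
  · by_cases hv : v ∈ F
    · obtain ⟨j, -, hj⟩ := hqin (c 0) h0.1 v hv (by omega)
      exact ⟨j, hj⟩
    · obtain ⟨m, hm⟩ := hreach (.inl v)
      obtain ⟨l, hl⟩ := hreach (.inl v₀)
      obtain ⟨j, -, hj⟩ := hqF m v hv (by rw [hm, ← hl]; exact hAp l _ (hAS v₀ hv₀)) _ h0.1
      exact ⟨j, hj⟩
  · have hH' : u ∉ F ∨ v ∉ F → ∃ j ≤ k, p^[j] (.inl u) = .inl v ∨ p^[j] (.inl v) = .inl u := by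
      intro h
      rcases hadj huv with h' | ⟨hu, hv⟩
      · exact hH h'
      · exact (h.elim (· (hAS u hu)) (· (hAS v hv))).elim
    by_cases hu : u ∈ F <;> by_cases hv : v ∈ F
    · rcases le_total (idx u) (idx v) with hle | hle
      · obtain ⟨j, hj, h⟩ := hqin u hu v hv hle
        exact ⟨j, by omega, .inr h⟩
      · obtain ⟨j, hj, h⟩ := hqin v hv u hu hle
        exact ⟨j, by omega, .inl h⟩
    · obtain ⟨j, hj, h | h⟩ := hH' (.inr hv)
      · exact (hv (show _ ∈ A from h ▸ hAp j _ hu)).elim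
      · obtain ⟨i, hi, h⟩ := hqF j v hv (h ▸ hu) u hu
        exact ⟨i, by omega, .inr h⟩
    · obtain ⟨j, hj, h | h⟩ := hH' (.inl hu)
      · obtain ⟨i, hi, h⟩ := hqF j u hu (h ▸ hv) v hv
        exact ⟨i, by omega, .inl h⟩
      · exact (hu (show _ ∈ A from h ▸ hAp j _ hv)).elim
    · obtain ⟨j, hj, h | h⟩ := hH' (.inl hu)
      · exact ⟨j, by omega, .inl (hqout j u hu v hv h)⟩
      · exact ⟨j, by omega, .inr (hqout j v hv u hu h)⟩

lemma IsParentLayout.exists_of_subdivideEdge {G : SimpleGraph V} {x y : V} {n k : ℕ}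
    {r : V ⊕ Fin (n + 1)} {p : V ⊕ Fin (n + 1) → V ⊕ Fin (n + 1)}
    (h : IsParentLayout (subdivideEdge G x y n) k r p) : ∃ k' r' p', IsParentLayout G k' r' p' := by
  refine h.exists_of_finite_modification (S := {x, y}) (Set.toFinite _) ⟨x, by simp⟩
    fun u v huv => ?_
  by_cases h1 : u = x ∧ v = y
  · exact .inr (by simp [h1])
  by_cases h2 : u = y ∧ v = x
  · exact .inr (by simp [h2])
  exact .inl (subdivideEdge_adj_inl huv h1 h2)

end Unsubdivide

/-- subdividing one edge increases treebandwidth by at most one. -/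
theorem treebandwidth_subdivideEdge_le {V : Type*} (G : SimpleGraph V) (x y : V)
    (hxy : G.Adj x y) (n : ℕ) :
    treebandwidth (subdivideEdge G x y n) ≤ treebandwidth G + 1 := by
  rcases Set.eq_empty_or_nonempty {k | ∃ L : TreeLayout G, L.BandwidthLE k} with hG | hG
  · have hH : {k | ∃ L : TreeLayout (subdivideEdge G x y n), L.BandwidthLE k} = ∅ := by
      refine Set.eq_empty_of_forall_notMem fun k ⟨L, hL⟩ => ?_
      obtain ⟨r, p, h⟩ := L.exists_isParentLayout hL
      obtain ⟨k', r', p', h'⟩ := h.exists_of_subdivideEdge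
      exact Set.eq_empty_iff_forall_notMem.1 hG k' h'.exists_treeLayout
    rw [treebandwidth, hH, Nat.sInf_empty]
    exact Nat.zero_le _
  · obtain ⟨L, hL⟩ := Nat.sInf_mem hG
    obtain ⟨r, p, h⟩ := L.exists_isParentLayout hL
    obtain ⟨r', p', h'⟩ := h.exists_subdivideEdge hxy n
    exact Nat.sInf_le h'.exists_treeLayout
end

section
/- Every vertex v of a 3-connected planar graph G is the center of a subdivision of the deg(v)-wheel, i.e. G contains a subgraph that is a subdivision of the wheel W on deg(v) spokes whose hub is v. -/
open SimpleGraph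

section WheelProof

variable {V : Type*} {G : SimpleGraph V}

/-- A list chained by adjacency stays so when reversed. -/
theorem List.IsChain.reverse_adj {l : List V} (h : l.IsChain G.Adj) :
    l.reverse.IsChain G.Adj :=
  List.isChain_reverse.2 (h.imp fun _ _ e => e.symm)

/-- The vertices of a nonempty list chained by adjacency induce a connected subgraph. -/
theorem List.IsChain.connected_induce {l : List V} (h : l.IsChain G.Adj) (hl : l ≠ []) :
    (G.induce {x | x ∈ l}).Connected := by
  have := (Walk.ofSupport l hl h).connected_induce_support
  rwa [Walk.support_ofSupport] at this

/-- A walk inside `s` that reaches `A` yields a path inside `s` that meets `A` only in its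
last vertex. -/
theorem exists_path_to_set {s : Set V} {w z : s} (p : (G.induce s).Walk w z) {A : Set V}
    (hz : (z : V) ∈ A) :
    ∃ (U : List V) (y : V), (U ++ [y]).head? = some (w : V) ∧ (U ++ [y]).IsChain G.Adj ∧
      U.Nodup ∧ (∀ u ∈ U, u ∉ A ∧ u ∈ s) ∧ y ∈ A ∧ y ∈ s := by
  induction p with
  | nil => exact ⟨[], _, by simp, by simp, by simp, by simp, hz, Subtype.property _⟩
  | @cons w' w z e p ih =>
    obtain ⟨U, y, hd, hc, hn, hU, hyA, hys⟩ := ih hz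
    by_cases hw'A : (w' : V) ∈ A
    · exact ⟨[], w', by simp, by simp, by simp, by simp, hw'A, w'.2⟩
    · by_cases hw'U : (w' : V) ∈ U
      · obtain ⟨X, Y, rfl⟩ := List.append_of_mem hw'U
        refine ⟨w' :: Y, y, by simp, ?_, ?_, ?_, hyA, hys⟩
        · rw [List.append_assoc] at hc; exact hc.right_of_append
        · exact (List.nodup_append.1 hn).2.1
        · intro u hu; exact hU u (by simp_all)
      · refine ⟨w' :: U, y, by simp, ?_, ?_, ?_, hyA, hys⟩
        · rw [List.cons_append, List.isChain_cons]
          refine ⟨fun q hq => ?_, hc⟩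
          rw [hd] at hq; simp at hq; subst hq; exact e
        · simp [hw'U, hn]
        · intro u hu
          rcases List.mem_cons.1 hu with rfl | hu
          · exact ⟨hw'A, w'.2⟩
          · exact hU u hu

/-- `exists_path_to_set` from a start vertex outside the target set. -/
theorem exists_path_to_set_of_notMem {s : Set V} (hs : (G.induce s).Connected) {w z : V}
    (hw : w ∈ s) (hzs : z ∈ s) {A : Set V} (hz : z ∈ A) (hwA : w ∉ A) :
    ∃ (T : List V) (y : V), (w :: T ++ [y]).IsChain G.Adj ∧
      (w :: T).Nodup ∧ (∀ u ∈ w :: T, u ∉ A ∧ u ∈ s) ∧ y ∈ A ∧ y ∈ s := by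
  obtain ⟨p⟩ := hs.preconnected ⟨w, hw⟩ ⟨z, hzs⟩
  obtain ⟨U, y, hd, hc, hn, hU, hyA, hys⟩ := exists_path_to_set p (A := A) hz
  cases U with
  | nil => simp at hd; subst hd; exact absurd hyA hwA
  | cons u T => simp at hd; subst hd; exact ⟨T, y, hc, hn, hU, hyA, hys⟩

/-- `R` is the list of inner vertices of a path in `G - v` with distinct ends `a`, `b` in `C`
and otherwise disjoint from `C`. -/
def IsEar (G : SimpleGraph V) (v : V) (C : Set V) (a : V) (R : List V) (b : V) : Prop :=
  a ∈ C ∧ b ∈ C ∧ a ≠ b ∧ (a :: R ++ [b]).IsChain G.Adj ∧ R.Nodup ∧ ∀ u ∈ R, u ∉ C ∧ u ≠ v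

set_option linter.unusedSimpArgs false in
/-- A neighbour of an inner vertex of an ear is an inner vertex of an ear. -/
theorem IsEar.exists_of_adj {v : V} {C : Set V} {a b x w : V} {R : List V}
    (h2 : (G.induce {u : V | u ≠ x ∧ u ≠ v}).Connected)
    (hvC : v ∉ C) (hR : IsEar G v C a R b) (hx : x ∈ R) (hxw : G.Adj x w) (hwv : w ≠ v)
    (hwC : w ∉ C) :
    ∃ a' R' b', IsEar G v C a' R' b' ∧ w ∈ R' := by
  by_cases hwR : w ∈ R
  · exact ⟨a, R, b, hR, hwR⟩
  obtain ⟨ha, hb, hab, hc, hn, hd⟩ := hR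
  have hCv : a ≠ x := by rintro rfl; exact (hd _ hx).1 ha
  have hav : a ≠ v := by rintro rfl; exact hvC ha
  obtain ⟨T, y, hTc, hTn, hTd, hyA, hyx, hyv⟩ := exists_path_to_set_of_notMem h2
    (w := w) (z := a) (A := C ∪ {u | u ∈ R}) ⟨hxw.ne', hwv⟩ ⟨hCv, hav⟩ (Or.inl ha)
    (by simp [hwC, hwR])
  obtain ⟨R₁, R₂, rfl⟩ := List.append_of_mem hx
  have hTr := hTc.reverse_adj
  simp only [List.reverse_append, List.reverse_cons, List.reverse_nil, List.nil_append,
    List.cons_append, List.append_assoc] at hTr hc hTc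
  rw [← List.cons_append, List.isChain_split] at hc
  obtain ⟨hc1, hc2⟩ := hc
  have hxT : (x :: w :: (T ++ [y])).IsChain G.Adj := by simp [hxw, hTc]
  have hTx : (y :: (T.reverse ++ w :: [x])).IsChain G.Adj := by
    rw [← List.cons_append, List.isChain_split]
    exact ⟨hTr, by simp [hxw.symm]⟩
  simp only [List.nodup_append, List.nodup_cons, List.mem_append, List.mem_cons,
    Set.mem_union, Set.mem_ofPred_eq] at hTn hn hd hTd hwR hyA
  by_cases hyC : y ∈ C
  · by_cases hyb : y = b
    · refine ⟨a, R₁ ++ x :: w :: T, y, ⟨ha, hyC, hyb ▸ hab, ?_, ?_, ?_⟩, by simp⟩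
      · simp only [List.append_assoc, List.cons_append]
        rw [← List.cons_append, List.isChain_split]
        exact ⟨hc1, hxT⟩
      · clear hc1 hc2 hTc hTr hxT hTx h2
        simp only [List.nodup_append, List.nodup_cons, List.nodup_reverse, List.mem_append,
          List.mem_cons, List.mem_reverse] at *
        grind
      · clear hc1 hc2 hTc hTr hxT hTx h2
        simp only [List.nodup_append, List.nodup_cons, List.nodup_reverse, List.mem_append,
          List.mem_cons, List.mem_reverse] at *
        grind
    · refine ⟨y, T.reverse ++ w :: x :: R₂, b, ⟨hyC, hb, hyb, ?_, ?_, ?_⟩, by simp⟩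
      · have := (List.isChain_split (l₁ := y :: (T.reverse ++ [w]))).2 ⟨by simpa using hTx, hc2⟩
        simpa using this
      · clear hc1 hc2 hTc hTr hxT hTx h2
        simp only [List.nodup_append, List.nodup_cons, List.nodup_reverse, List.mem_append,
          List.mem_cons, List.mem_reverse] at *
        grind
      · clear hc1 hc2 hTc hTr hxT hTx h2
        simp only [List.nodup_append, List.nodup_cons, List.nodup_reverse, List.mem_append,
          List.mem_cons, List.mem_reverse] at *
        grind
  · have hyR : y ∈ R₁ ∨ y ∈ R₂ := by
      rcases hyA with h | h
      · exact absurd h hyC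
      · tauto
    rcases hyR with h | h
    · obtain ⟨X, Y, rfl⟩ := List.append_of_mem h
      refine ⟨a, X ++ y :: (T.reverse ++ w :: x :: R₂), b, ⟨ha, hb, hab, ?_, ?_, ?_⟩, by simp⟩
      · have h1 : (a :: X ++ [y]).IsChain G.Adj := by
          have : (a :: X ++ y :: (Y ++ [x])).IsChain G.Adj := by simpa using hc1
          exact (List.isChain_split.1 this).1
        have h2 := (List.isChain_split (l₁ := y :: (T.reverse ++ [w]))).2
          ⟨by simpa using hTx, hc2⟩
        simp only [List.cons_append, List.append_assoc, List.nil_append] at h2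
        have := (List.isChain_split (l₁ := a :: X)).2 ⟨h1, h2⟩
        simpa using this
      · clear hc1 hc2 hTc hTr hxT hTx h2
        simp only [List.nodup_append, List.nodup_cons, List.nodup_reverse, List.mem_append,
          List.mem_cons, List.mem_reverse] at *
        grind
      · clear hc1 hc2 hTc hTr hxT hTx h2
        simp only [List.nodup_append, List.nodup_cons, List.nodup_reverse, List.mem_append,
          List.mem_cons, List.mem_reverse] at *
        grind
    · obtain ⟨X, Y, rfl⟩ := List.append_of_mem h
      refine ⟨a, R₁ ++ x :: w :: (T ++ y :: Y), b, ⟨ha, hb, hab, ?_, ?_, ?_⟩, by simp⟩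
      · have h1 : (y :: (Y ++ [b])).IsChain G.Adj := by
          have : (x :: X ++ y :: (Y ++ [b])).IsChain G.Adj := by simpa using hc2
          exact (List.isChain_split.1 this).2
        have h2 := (List.isChain_split (l₁ := x :: w :: T)).2 ⟨by simpa using hxT, h1⟩
        have := (List.isChain_split (l₁ := a :: R₁)).2 ⟨by simpa using hc1, h2⟩
        simpa using this
      · clear hc1 hc2 hTc hTr hxT hTx h2
        simp only [List.nodup_append, List.nodup_cons, List.nodup_reverse, List.mem_append,
          List.mem_cons, List.mem_reverse] at *
        grind
      · clear hc1 hc2 hTc hTr hxT hTx h2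
        simp only [List.nodup_append, List.nodup_cons, List.nodup_reverse, List.mem_append,
          List.mem_cons, List.mem_reverse] at *
        grind

/-- In a graph such that `G - v` has no cutvertex, every vertex outside a set `C` with at least
two elements lies on an ear of `C`. -/
theorem exists_isEar {v : V} (h2 : ∀ x, (G.induce {u : V | u ≠ x ∧ u ≠ v}).Connected)
    {C : Set V} (hvC : v ∉ C) (hC : C.Nontrivial) {w : V} (hwv : w ≠ v) (hwC : w ∉ C) :
    ∃ a R b, IsEar G v C a R b ∧ w ∈ R := by
  obtain ⟨c, hc⟩ := hC.nonempty
  have hcv : c ≠ v := by rintro rfl; exact hvC hc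
  obtain ⟨p⟩ := (h2 v).preconnected ⟨w, hwv, hwv⟩ ⟨c, hcv, hcv⟩
  suffices H : ∀ {x z : {u : V | u ≠ v ∧ u ≠ v}}, (G.induce {u : V | u ≠ v ∧ u ≠ v}).Walk x z →
      (z : V) ∈ C → (x : V) ∉ C → ∃ a R b, IsEar G v C a R b ∧ (x : V) ∈ R from H p hc hwC
  intro x z p hz hx
  induction p with
  | nil => exact absurd hz hx
  | @cons w x z e p ih =>
    have e : G.Adj (x : V) (w : V) := (by simpa using e : G.Adj (w : V) x).symm
    by_cases hxC : (x : V) ∈ C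
    · obtain ⟨d, hd, hdx⟩ := hC.exists_ne (x : V)
      obtain ⟨T, y, hTc, hTn, hTd, hyA, hyx, hyv⟩ := exists_path_to_set_of_notMem (h2 x)
        (w := (w : V)) (z := d) (A := C) ⟨e.ne', w.2.1⟩
        ⟨hdx, by rintro rfl; exact hvC hd⟩ hd hx
      refine ⟨x, w :: T, y, ⟨hxC, hyA, hyx.symm, ?_, hTn, fun u hu => ?_⟩, by simp⟩
      swap
      · exact ⟨(hTd u hu).1, (hTd u hu).2.2⟩
      simpa [e] using hTc
    · obtain ⟨a, R, b, hR, hxR⟩ := ih hz hxC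
      exact IsEar.exists_of_adj (h2 x) hvC hR hxR e w.2.1 hx


/-- Three distinct vertices, each adjacent to each of three disjoint paths avoiding them,
give a `K₃,₃` minor. -/
theorem hasMinor_completeBipartiteGraph_three {c : Fin 3 → V} {L : Fin 3 → List V}
    (hc : Function.Injective c) (hL : ∀ j, (L j).IsChain G.Adj)
    (hd : ∀ i j, i ≠ j → ∀ x ∈ L i, x ∉ L j) (hcL : ∀ i j, c i ∉ L j)
    (hadj : ∀ i j, ∃ y ∈ L j, G.Adj (c i) y) :
    HasMinor G (completeBipartiteGraph (Fin 3) (Fin 3)) := by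
  refine ⟨Sum.elim (fun i => {c i}) (fun j => {x | x ∈ L j}), ?_, ?_, ?_⟩
  · rintro (i | j)
    · change (G.induce ({c i} : Set V)).Connected
      exact Connected.of_subsingleton
    · obtain ⟨y, hy, -⟩ := hadj 0 j
      exact (hL j).connected_induce (List.ne_nil_of_mem hy)
  · rintro (i | j) (i' | j') hne
    · simpa [hc.eq_iff] using fun h => hne (congrArg Sum.inl h)
    · simpa using hcL i j'
    · simpa using hcL i' j
    · exact Set.disjoint_left.2 fun x hx => hd j j' (fun h => hne (congrArg Sum.inr h)) x hx
  · rintro (i | j) (i' | j') h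
    · simp at h
    · obtain ⟨y, hy, e⟩ := hadj i j'
      exact ⟨c i, rfl, y, hy, e⟩
    · obtain ⟨y, hy, e⟩ := hadj i' j
      exact ⟨y, hy, c i', rfl, e.symm⟩
    · simp at h

/-- The inner vertices of a nontrivial path contain neighbours of both ends. -/
theorem exists_adj_of_isChain {a b : V} {P : List V} (h : (a :: P ++ [b]).IsChain G.Adj)
    (hP : P ≠ []) : (∃ y ∈ P, G.Adj a y) ∧ ∃ y ∈ P, G.Adj b y := by
  constructor
  · cases P with
    | nil => exact absurd rfl hP
    | cons y P => exact ⟨y, by simp, by simpa using (List.isChain_cons_cons.1 h).1⟩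
  · obtain ⟨P, y, rfl⟩ := List.eq_nil_or_concat P |>.resolve_left hP
    refine ⟨y, by simp, ?_⟩
    have : (a :: P ++ y :: [b]).IsChain G.Adj := by simpa using h
    exact (by simpa using (List.isChain_split.1 this).2 : G.Adj y b).symm

/-- `a :: T` is the cyclic vertex sequence of a cycle of `G - v`, where going back and forth
along one edge is allowed. -/
def IsCyc (G : SimpleGraph V) (v a : V) (T : List V) : Prop :=
  (a :: T).Nodup ∧ (a :: T ++ [a]).IsChain G.Adj ∧ v ∉ a :: T

theorem IsCyc.rotate {v a b : V} {X Y : List V} (h : IsCyc G v a (X ++ b :: Y)) :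
    IsCyc G v b (Y ++ a :: X) := by
  obtain ⟨hn, hc, hv⟩ := h
  refine ⟨?_, ?_, ?_⟩
  · have : (a :: X ++ b :: Y).Perm (b :: Y ++ a :: X) := List.perm_append_comm
    exact this.nodup hn
  · have h1 : (a :: X ++ b :: (Y ++ [a])).IsChain G.Adj := by simpa using hc
    obtain ⟨h1, h2⟩ := List.isChain_split.1 h1
    have := (List.isChain_split (l₁ := b :: Y)).2 ⟨h2, h1⟩
    simpa using this
  · simp at hv ⊢; tauto

theorem IsCyc.reverse {v a : V} {T : List V} (h : IsCyc G v a T) : IsCyc G v a T.reverse := by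
  obtain ⟨hn, hc, hv⟩ := h
  exact ⟨by simpa using hn, by simpa using hc.reverse_adj, by simpa using hv⟩

/-- Any two vertices of a cycle split it into two arcs. -/
theorem IsCyc.exists_split {v c a b : V} {T : List V} (h : IsCyc G v c T) (ha : a ∈ c :: T)
    (hb : b ∈ c :: T) (hab : a ≠ b) :
    ∃ P Q, IsCyc G v a (P ++ b :: Q) ∧ ∀ u, u ∈ c :: T ↔ u ∈ a :: (P ++ b :: Q) := by
  obtain ⟨U, hU, hm⟩ : ∃ U, IsCyc G v a U ∧ ∀ u, u ∈ c :: T ↔ u ∈ a :: U := by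
    rcases List.mem_cons.1 ha with rfl | ha
    · exact ⟨T, h, fun u => Iff.rfl⟩
    · obtain ⟨X, Y, rfl⟩ := List.append_of_mem ha
      exact ⟨_, h.rotate, fun u => by simp; tauto⟩
  have hbU : b ∈ U := ((List.mem_cons.1 ((hm b).1 hb)).resolve_left hab.symm)
  obtain ⟨P, Q, rfl⟩ := List.append_of_mem hbU
  exact ⟨P, Q, hU, hm⟩

/-- Replacing an arc of a cycle by an ear. -/
theorem IsCyc.replace_arc {v a b : V} {P Q R : List V} (h : IsCyc G v a (P ++ b :: Q))
    (hR : (a :: R ++ [b]).IsChain G.Adj) (hRn : R.Nodup)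
    (hRd : ∀ u ∈ R, u ∉ a :: (P ++ b :: Q) ∧ u ≠ v) : IsCyc G v a (R ++ b :: Q) := by
  obtain ⟨hn, hc, hv⟩ := h
  have h1 : (a :: P ++ b :: (Q ++ [a])).IsChain G.Adj := by simpa using hc
  refine ⟨?_, ?_, ?_⟩
  · clear hc h1 hR
    simp only [List.nodup_append, List.nodup_cons, List.mem_append, List.mem_cons] at *
    grind
  · have := List.isChain_split.2 ⟨hR, (List.isChain_split.1 h1).2⟩
    simpa using this
  · clear hc h1 hR
    simp only [List.mem_append, List.mem_cons] at *
    grind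

/-- In a graph without `K₃,₃` minor such that `G - v` has no cutvertex, a cycle of `G - v` can be
rerouted through one more neighbour of `v`, keeping all neighbours of `v` on it. -/
theorem IsCyc.exists_insert {v c w : V} {T : List V}
    (hK : ¬ HasMinor G (completeBipartiteGraph (Fin 3) (Fin 3)))
    (h2 : ∀ x, (G.induce {u : V | u ≠ x ∧ u ≠ v}).Connected)
    (h : IsCyc G v c T) (hvw : G.Adj v w) :
    ∃ c' T', IsCyc G v c' T' ∧ w ∈ c' :: T' ∧
      ∀ u, G.Adj v u → u ∈ c :: T → u ∈ c' :: T' := by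
  by_cases hw : w ∈ c :: T
  · exact ⟨c, T, h, hw, fun u _ hu => hu⟩
  have hT : T ≠ [] := by
    rintro rfl
    simpa using h.2.1
  have hnt : {u | u ∈ c :: T}.Nontrivial := by
    obtain ⟨d, hd⟩ := List.exists_mem_of_ne_nil T hT
    refine ⟨c, by simp, d, by simp [hd], ?_⟩
    rintro rfl
    exact (List.nodup_cons.1 h.1).1 hd
  obtain ⟨a, R, b, ⟨ha, hb, hab, hRc, hRn, hRd⟩, hwR⟩ :=
    exists_isEar h2 (C := {u | u ∈ c :: T}) h.2.2 hnt hvw.ne' hw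
  obtain ⟨P, Q, hPQ, hm⟩ := h.exists_split ha hb hab
  have hRd' : ∀ u ∈ R, u ∉ a :: (P ++ b :: Q) ∧ u ≠ v := fun u hu =>
    ⟨fun h' => (hRd u hu).1 ((hm u).2 h'), (hRd u hu).2⟩
  by_cases hP : ∃ p ∈ P, G.Adj v p
  · by_cases hQ : ∃ q ∈ Q, G.Adj v q
    · obtain ⟨p, hp, hvp⟩ := hP
      obtain ⟨q, hq, hvq⟩ := hQ
      obtain ⟨hn, hc, hv⟩ := hPQ
      have hc' : (a :: P ++ b :: (Q ++ [a])).IsChain G.Adj := by simpa using hc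
      obtain ⟨hPc, hQc⟩ := List.isChain_split.1 hc'
      refine absurd (hasMinor_completeBipartiteGraph_three (c := ![a, b, v]) (L := ![P, Q, R])
        ?_ ?_ ?_ ?_ ?_) hK
      · clear hc hc' hPc hQc hRc hm h2
        simp only [List.nodup_append, List.nodup_cons, List.mem_append, List.mem_cons] at *
        intro i j hij
        fin_cases i <;> fin_cases j <;> simp at hij ⊢ <;> grind
      · have hPc' := hPc.tail.left_of_append
        have hQc' := hQc.tail.left_of_append
        have hRc' := hRc.tail.left_of_append
        intro j
        fin_cases j
        · exact hPc'
        · exact hQc'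
        · exact hRc'
      · clear hc hc' hPc hQc hRc hm h2
        simp only [List.nodup_append, List.nodup_cons, List.mem_append, List.mem_cons] at *
        intro i j hij x
        fin_cases i <;> fin_cases j <;> simp at hij ⊢ <;> grind
      · clear hc hc' hPc hQc hRc hm h2
        simp only [List.nodup_append, List.nodup_cons, List.mem_append, List.mem_cons] at *
        intro i j
        fin_cases i <;> fin_cases j <;> simp <;> grind
      · have e1 := exists_adj_of_isChain hPc (List.ne_nil_of_mem hp)
        have e2 := exists_adj_of_isChain hQc (List.ne_nil_of_mem hq)
        have e3 := exists_adj_of_isChain hRc (List.ne_nil_of_mem hwR)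
        intro i j
        fin_cases i <;> fin_cases j
        exacts [e1.1, e2.2, e3.1, e1.2, e2.1, e3.2, ⟨p, hp, hvp⟩, ⟨q, hq, hvq⟩, ⟨w, hwR, hvw⟩]
    · have hPQ' : IsCyc G v a (Q.reverse ++ b :: P.reverse) := by simpa using hPQ.reverse
      refine ⟨a, R ++ b :: P.reverse, hPQ'.replace_arc hRc hRn ?_, by simp [hwR], ?_⟩
      · intro u hu
        have := hRd' u hu
        simp only [List.mem_append, List.mem_cons, List.mem_reverse] at *
        tauto
      · intro u hvu hu
        have := (hm u).1 hu
        simp only [List.mem_append, List.mem_cons, List.mem_reverse] at *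
        grind
  · refine ⟨a, R ++ b :: Q, hPQ.replace_arc hRc hRn hRd', by simp [hwR], ?_⟩
    intro u hvu hu
    have := (hm u).1 hu
    simp only [List.mem_append, List.mem_cons] at *
    grind

/-- In a 3-connected graph without `K₃,₃` minor, the neighbours of a vertex `v` lie on a common
cycle of `G - v`. -/
theorem ThreeConnected.exists_isCyc [Finite V] (hG : ThreeConnected G)
    (hK : ¬ HasMinor G (completeBipartiteGraph (Fin 3) (Fin 3))) (v : V) (S : Finset V)
    (hS : ∀ u ∈ S, G.Adj v u) : ∃ c T, IsCyc G v c T ∧ ∀ u ∈ S, u ∈ c :: T := by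
  classical
  have h2 : ∀ x, (G.induce {u : V | u ≠ x ∧ u ≠ v}).Connected := fun x => hG.2 x v
  induction S using Finset.induction_on with
  | empty =>
    have hnt : Nontrivial {u : V | u ≠ v ∧ u ≠ v} := by
      rw [Set.nontrivial_coe_sort, ← Set.one_lt_ncard_iff_nontrivial]
      have h1 : {u : V | u ≠ v ∧ u ≠ v} = {v}ᶜ := by ext; simp
      have h3 := Set.ncard_add_ncard_compl ({v} : Set V)
      have h4 := hG.1
      rw [h1]
      rw [Set.ncard_singleton] at h3
      omega
    obtain ⟨x⟩ := hnt.to_nonempty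
    obtain ⟨y, e⟩ := (h2 v).preconnected.exists_adj_of_nontrivial x
    have e : G.Adj (x : V) y := e
    exact ⟨x, [y], ⟨by simpa using e.ne, by simp [e, e.symm],
      by simpa using ⟨x.2.1.symm, y.2.1.symm⟩⟩, by simp⟩
  | insert w S _ ih =>
    obtain ⟨c, T, hT, hST⟩ := ih fun u hu => hS u (Finset.mem_insert_of_mem hu)
    obtain ⟨c', T', hT', hw, hu⟩ := hT.exists_insert hK h2 (hS w (Finset.mem_insert_self w S))
    refine ⟨c', T', hT', fun u hu' => ?_⟩
    rcases Finset.mem_insert.1 hu' with rfl | hu'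
    · exact hw
    · exact hu u (hS u (Finset.mem_insert_of_mem hu')) (hST u hu')

/-- Along a sequence of successively adjacent vertices, any two terms are joined by a path using
only intermediate terms. -/
theorem exists_isPath_of_forall_adj_succ {f : ℕ → V} (hf : ∀ i, G.Adj (f i) (f (i + 1)))
    {s t : ℕ} (hst : s ≤ t) :
    ∃ p : G.Walk (f s) (f t), p.IsPath ∧ ∀ x ∈ p.support, ∃ j, s ≤ j ∧ j ≤ t ∧ f j = x := by
  classical
  suffices H : ∃ p : G.Walk (f s) (f t), ∀ x ∈ p.support, ∃ j, s ≤ j ∧ j ≤ t ∧ f j = x by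
    obtain ⟨p, hp⟩ := H
    exact ⟨p.bypass, p.bypass_isPath, fun x hx => hp x (p.support_bypass_subset_support hx)⟩
  induction t, hst using Nat.le_induction with
  | base => exact ⟨.nil, fun x hx => ⟨s, le_rfl, le_rfl, by simp_all⟩⟩
  | succ t hst ih =>
    obtain ⟨p, hp⟩ := ih
    refine ⟨p.concat (hf t), fun x hx => ?_⟩
    rw [Walk.support_concat, List.mem_append, List.mem_singleton] at hx
    rcases hx with hx | rfl
    · obtain ⟨j, h1, h2, h3⟩ := hp x hx
      exact ⟨j, h1, by omega, h3⟩
    · exact ⟨t + 1, by omega, le_rfl, rfl⟩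

/-- A cycle of `G - v`, given as a periodic vertex sequence, through all neighbours of `v` yields
a wheel with hub `v`. -/
theorem nonempty_wheelSubdivision_of_periodic [Fintype V] [DecidableRel G.Adj] {v : V} {n : ℕ}
    {f : ℕ → V} (hadj : ∀ i, G.Adj (f i) (f (i + 1))) (hper : ∀ i, f (i + n) = f i)
    (hinj : ∀ i j, f i = f j → i ≡ j [MOD n]) (hv : ∀ i, f i ≠ v)
    (hN : ∀ u, G.Adj v u → ∃ i < n, f i = u) :
    Nonempty (WheelSubdivision G v (G.degree v)) := by
  classical
  have hcard : ((Finset.range n).filter fun i => G.Adj v (f i)).card = G.degree v := by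
    rw [← G.card_neighborFinset_eq_degree, ← Finset.card_image_of_injOn (f := f)]
    · congr 1
      ext u
      simp only [Finset.mem_image, Finset.mem_filter, Finset.mem_range, mem_neighborFinset]
      constructor
      · rintro ⟨i, ⟨-, h⟩, rfl⟩
        exact h
      · intro h
        obtain ⟨i, hi, rfl⟩ := hN u h
        exact ⟨i, ⟨hi, h⟩, rfl⟩
    · intro i hi j hj hij
      simp only [Finset.coe_filter, Finset.mem_range, Set.mem_ofPred_eq] at hi hj
      exact (hinj i j hij).eq_of_lt_of_lt hi.1 hj.1
  generalize G.degree v = d at hcard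
  let p := Finset.orderEmbOfFin _ hcard
  have hp : ∀ i, p i < n ∧ G.Adj v (f (p i)) := fun i => by
    have := Finset.orderEmbOfFin_mem _ hcard i
    rwa [Finset.mem_filter, Finset.mem_range] at this
  have hmono : ∀ i j, i < j → p i < p j := fun i j h => p.strictMono h
  clear_value p
  rcases d with _ | d
  · exact ⟨{ b := finZeroElim, binj := fun i => i.elim0, bne := finZeroElim,
             spoke := finZeroElim, spokePath := finZeroElim, seg := finZeroElim,
             segPath := finZeroElim, vNotinSeg := finZeroElim, spokeDisj := finZeroElim,
             spokeSegDisj := finZeroElim, segDisj := finZeroElim }⟩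
  have hp0 : ∀ i, p 0 ≤ p i := fun i => p.monotone (Fin.zero_le i)
  -- `e i` is the position at which the segment starting at position `p i` ends
  obtain ⟨e, hfe, hpe, he0, hlt⟩ : ∃ e : Fin (d + 1) → ℕ,
      (∀ i, f (e i) = f (p (finRotate (d + 1) i))) ∧ (∀ i, p i < e i) ∧
      (∀ i, e i ≤ p 0 + n) ∧ ∀ i j, i < j → e i ≤ p j := by
    refine ⟨fun i => if i = Fin.last d then p 0 + n else p (finRotate (d + 1) i), ?_, ?_, ?_, ?_⟩
    · intro i
      by_cases hi : i = Fin.last d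
      · simp [hi, hper]
      · simp [hi]
    · intro i
      by_cases hi : i = Fin.last d
      · simp only [hi, if_true]
        have := (hp (Fin.last d)).1
        omega
      · simp only [hi, if_false]
        exact hmono _ _ ((lt_finRotate_iff_ne_last i).2 hi)
    · intro i
      by_cases hi : i = Fin.last d
      · simp [hi]
      · simp only [hi, if_false]
        have := (hp (finRotate (d + 1) i)).1
        omega
    · intro i j hij
      have hi : i ≠ Fin.last d := ne_of_lt (lt_of_lt_of_le hij (Fin.le_last j))
      simp only [hi, if_false]
      apply p.monotone
      rw [Fin.le_def, coe_finRotate_of_ne_last hi]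
      exact hij
  have hkey : ∀ s t, p 0 ≤ s → s ≤ t → t ≤ p 0 + n → f s = f t →
      s = t ∨ (s = p 0 ∧ t = p 0 + n) := by
    intro s t hs hst ht h
    obtain ⟨k, hk⟩ := (Nat.modEq_iff_dvd' hst).1 (hinj s t h)
    rcases k with _ | _ | k
    · left; omega
    · right; omega
    · have : n * 2 ≤ n * (k + 1 + 1) := Nat.mul_le_mul_left n (by omega)
      have := (hp 0).1
      omega
  have hseg : ∀ i, ∃ q : G.Walk (f (p i)) (f (p (finRotate (d + 1) i))), q.IsPath ∧
      ∀ x ∈ q.support, ∃ j, p i ≤ j ∧ j ≤ e i ∧ f j = x := by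
    intro i
    rw [← hfe i]
    exact exists_isPath_of_forall_adj_succ hadj (hpe i).le
  choose seg hsegPath hsegSupp using hseg
  have hvseg : ∀ i, v ∉ (seg i).support := fun i h => by
    obtain ⟨j, -, -, hj⟩ := hsegSupp i v h
    exact hv j hj
  have hpinj : ∀ i j, f (p i) = f (p j) → i = j := fun i j h =>
    p.injective ((hinj _ _ h).eq_of_lt_of_lt (hp i).1 (hp j).1)
  have hsegDisj : ∀ i j, i < j → ∀ x ∈ (seg i).support, x ∈ (seg j).support →
      (x = f (p i) ∨ x = f (p (finRotate (d + 1) i))) ∧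
      (x = f (p j) ∨ x = f (p (finRotate (d + 1) j))) := by
    intro i j hij x hxi hxj
    obtain ⟨s, hs1, hs2, rfl⟩ := hsegSupp i x hxi
    obtain ⟨t, ht1, ht2, hts⟩ := hsegSupp j _ hxj
    have h1 := hlt i j hij
    have h2 := hp0 i
    have h3 := he0 j
    rw [← hfe, ← hfe]
    rcases hkey s t (by omega) (by omega) (by omega) hts.symm with h | ⟨h, h'⟩
    · obtain rfl : s = e i := by omega
      exact ⟨.inr rfl, .inl (congrArg f (by omega))⟩
    · exact ⟨.inl (congrArg f (by omega)), .inr (hts.symm.trans (congrArg f (by omega)))⟩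
  exact ⟨{
    b := fun i => f (p i)
    binj := fun i j h => hpinj i j h
    bne := fun i => hv _
    spoke := fun i => (hp i).2.toWalk
    spokePath := fun i => by simpa using (hp i).2.ne
    seg := seg
    segPath := hsegPath
    vNotinSeg := hvseg
    spokeDisj := by
      intro i j hij
      ext x
      simp only [Walk.support_cons, Walk.support_nil, Adj.toWalk, Set.mem_inter_iff,
        Set.mem_ofPred_eq, List.mem_cons, List.not_mem_nil, or_false, Set.mem_singleton_iff]
      constructor
      · rintro ⟨rfl | rfl, h | h⟩
        · rfl
        · rfl
        · exact h
        · exact absurd (hpinj i j h) hij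
      · rintro rfl
        exact ⟨.inl rfl, .inl rfl⟩
    spokeSegDisj := by
      rintro i j x ⟨hx, hxj⟩
      simp only [Walk.support_cons, Walk.support_nil, Adj.toWalk, Set.mem_ofPred_eq,
        List.mem_cons, List.not_mem_nil, or_false] at hx hxj
      rcases hx with rfl | rfl
      · exact absurd hxj (hvseg j)
      · refine ⟨rfl, ?_⟩
        rw [Set.mem_insert_iff, Set.mem_singleton_iff]
        rcases lt_trichotomy i j with h | rfl | h
        · exact (hsegDisj i j h _ (Walk.start_mem_support _) hxj).2
        · exact .inl rfl
        · obtain ⟨s, hs1, hs2, hs⟩ := hsegSupp j _ hxj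
          have h1 := hlt j i h
          have h2 := hp0 j
          have h3 := (hp i).1
          rcases hkey s (p i) (by omega) (by omega) (by omega) hs with h4 | ⟨h4, h5⟩
          · right
            rw [← hfe]
            exact congrArg f (by omega)
          · omega
    segDisj := by
      rintro i j hij x ⟨hxi, hxj⟩
      simp only [Set.mem_ofPred_eq] at hxi hxj
      simp only [Set.mem_inter_iff, Set.mem_insert_iff, Set.mem_singleton_iff]
      rcases lt_or_gt_of_ne hij with h | h
      · exact hsegDisj i j h x hxi hxj
      · exact (hsegDisj j i h x hxj hxi).symm }⟩

/-- A cycle of `G - v` through all neighbours of `v` yields a wheel with hub `v`. -/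
theorem IsCyc.nonempty_wheelSubdivision [Fintype V] [DecidableRel G.Adj] {v c : V} {T : List V}
    (h : IsCyc G v c T) (hN : ∀ u, G.Adj v u → u ∈ c :: T) :
    Nonempty (WheelSubdivision G v (G.degree v)) := by
  obtain ⟨hn, hc, hv⟩ := h
  have hlt : ∀ i, i % (c :: T).length < (c :: T).length := fun i => Nat.mod_lt _ (by simp)
  refine nonempty_wheelSubdivision_of_periodic (n := (c :: T).length)
    (f := fun i => (c :: T)[i % (c :: T).length]'(hlt i)) ?_ ?_ ?_ ?_ ?_
  · have hstep : ∀ k (hk : k < (c :: T).length),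
        G.Adj (c :: T)[k] ((c :: T)[(k + 1) % (c :: T).length]'(hlt _)) := by
      intro k hk
      have := List.isChain_iff_getElem.1 hc k (by simpa using hk)
      rcases Nat.lt_or_ge (k + 1) (c :: T).length with hk' | hk'
      · simp only [Nat.mod_eq_of_lt hk']
        rwa [List.getElem_append_left hk, List.getElem_append_left hk'] at this
      · have hk' : k + 1 = (c :: T).length := by omega
        simp only [hk', Nat.mod_self]
        rw [List.getElem_append_left hk, List.getElem_append_right (by omega)] at this
        simpa [hk'] using this
    intro i
    have := hstep _ (hlt i)
    simp only [Nat.mod_add_mod] at this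
    exact this
  · intro i
    simp
  · intro i j hij
    exact (hn.getElem_inj_iff).1 hij
  · intro i hi
    exact hv (hi ▸ List.getElem_mem _)
  · intro u hu
    obtain ⟨i, hi, rfl⟩ := List.getElem_of_mem (hN u hu)
    exact ⟨i, hi, by simp only [Nat.mod_eq_of_lt hi]⟩

end WheelProof

/-- every vertex of a 3-connected planar graph is the hub of a subdivided
`deg(v)`-wheel. -/
theorem wheel_of_threeConnected_planar {V : Type*} [Fintype V] (G : SimpleGraph V)
    [DecidableRel G.Adj] (hG : ThreeConnected G) (hplanar : PlanarWagner G) (v : V) :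
    Nonempty (WheelSubdivision G v (G.degree v)) := by
  obtain ⟨c, T, hT, hN⟩ := hG.exists_isCyc hplanar.2 v (G.neighborFinset v) (by simp)
  exact hT.nonempty_wheelSubdivision fun u hu => hN u (by simpa using hu)
end

section
/- If a simple graph G contains no subdivision of the 4-fan F_4 (the gem) as a subgraph, then in any SPQR tree of a 2-connected component of G, the torso of every R-node has maximum degree at most 3. -/
open SimpleGraph

/-- `S` is the vertex set of a path of `G` from `a` to `b`. -/
def IsPathSupport {V : Type*} (G : SimpleGraph V) (S : Set V) (a b : V) : Prop :=
  ∃ p : G.Walk a b, p.IsPath ∧ S = {x | x ∈ p.support}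

/-- Some walk of `G` from `a` to `b` stays inside `S`. -/
def JoinedWithin {V : Type*} (G : SimpleGraph V) (S : Set V) (a b : V) : Prop :=
  ∃ p : G.Walk a b, ∀ x ∈ p.support, x ∈ S

namespace JoinedWithin

variable {V : Type*} {G : SimpleGraph V} {S T : Set V} {a b c : V}

theorem mono (h : JoinedWithin G S a b) (hST : S ⊆ T) : JoinedWithin G T a b :=
  let ⟨p, hp⟩ := h
  ⟨p, fun x hx => hST (hp x hx)⟩

theorem cons (hac : G.Adj a c) (h : JoinedWithin G S c b) :
    JoinedWithin G (insert a S) a b := by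
  obtain ⟨p, hp⟩ := h
  refine ⟨.cons hac p, fun x hx => ?_⟩
  rw [Walk.support_cons, List.mem_cons] at hx
  exact hx.imp id (hp x)

theorem exists_isPath (h : JoinedWithin G S a b) :
    ∃ p : G.Walk a b, p.IsPath ∧ ∀ x ∈ p.support, x ∈ S := by
  classical
  obtain ⟨p, hp⟩ := h
  exact ⟨p.bypass, p.bypass_isPath, fun x hx => hp x (p.support_bypass_subset_support hx)⟩

theorem of_induce (ha : a ∈ S) (hb : b ∈ S) (h : (G.induce S).Preconnected) :
    JoinedWithin G S a b := by
  obtain ⟨p⟩ := h ⟨a, ha⟩ ⟨b, hb⟩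
  refine ⟨p.map (Embedding.induce S).toHom, fun x hx => ?_⟩
  obtain ⟨y, -, rfl⟩ := List.mem_map.1
    ((congrArg (x ∈ ·) (Walk.support_map (Embedding.induce S).toHom p)).mp hx)
  exact y.2

/-- A walk ending in `K` contains a path which meets `K` only in its last vertex. -/
theorem exists_first_hit {K : Set V} (h : JoinedWithin G S a b) (hb : b ∈ K) :
    ∃ r ∈ K, ∃ Q ⊆ S, IsPathSupport G Q a r ∧ Q ∩ K ⊆ {r} := by
  suffices H : ∃ r ∈ K, JoinedWithin G {x | x ∈ S ∧ (x ∈ K → x = r)} a r by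
    obtain ⟨r, hr, hj⟩ := H
    obtain ⟨p, hp, hpS⟩ := hj.exists_isPath
    exact ⟨r, hr, _, fun x hx => (hpS x hx).1, ⟨p, hp, rfl⟩, fun x hx => (hpS x hx.1).2 hx.2⟩
  obtain ⟨p, hp⟩ := h
  induction p with
  | nil => exact ⟨_, hb, .nil, fun x hx => ⟨hp x hx, fun _ => by simpa using hx⟩⟩
  | @cons u v _ huv p ih =>
    by_cases hu : u ∈ K
    · refine ⟨u, hu, .nil, fun x hx => ?_⟩
      obtain rfl : x = u := by simpa using hx
      exact ⟨hp x (Walk.start_mem_support _), fun _ => rfl⟩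
    · obtain ⟨r, hr, hj⟩ := ih hb fun x hx => hp x (by simp [hx])
      refine ⟨r, hr, (hj.cons huv).mono ?_⟩
      rintro x (rfl | hx)
      · exact ⟨hp x (Walk.start_mem_support _), fun h => absurd h hu⟩
      · exact hx

end JoinedWithin

namespace IsPathSupport

variable {V : Type*} {G : SimpleGraph V} {S : Set V} {a b r : V}

theorem refl (a : V) : IsPathSupport G {a} a a :=
  ⟨.nil, .nil, by ext; simp⟩

theorem symm (h : IsPathSupport G S a b) : IsPathSupport G S b a := by
  obtain ⟨p, hp, rfl⟩ := h
  exact ⟨p.reverse, hp.reverse, by ext; simp⟩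

theorem joinedWithin (h : IsPathSupport G S a b) : JoinedWithin G S a b := by
  obtain ⟨p, -, rfl⟩ := h
  exact ⟨p, fun _ => id⟩

theorem left_mem (h : IsPathSupport G S a b) : a ∈ S := by
  obtain ⟨p, -, rfl⟩ := h
  exact p.start_mem_support

theorem right_mem (h : IsPathSupport G S a b) : b ∈ S :=
  h.symm.left_mem

theorem split (h : IsPathSupport G S a b) (hr : r ∈ S) :
    ∃ A B, IsPathSupport G A a r ∧ IsPathSupport G B r b ∧ A ⊆ S ∧ B ⊆ S ∧ A ∩ B ⊆ {r} := by
  classical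
  obtain ⟨p, hp, rfl⟩ := h
  refine ⟨_, _, ⟨p.takeUntil r hr, hp.takeUntil hr, rfl⟩, ⟨p.dropUntil r hr, hp.dropUntil hr, rfl⟩,
    fun x hx => p.support_takeUntil_subset_support hr hx,
    fun x hx => p.support_dropUntil_subset_support hr hx, ?_⟩
  rintro x ⟨hxA, hxB⟩
  by_contra hne
  have hnd := hp.support_nodup
  rw [← p.take_spec hr, Walk.support_append, List.nodup_append'] at hnd
  refine hnd.2.2 hxA ?_
  have hx : x ∈ (p.dropUntil r hr).support := hxB
  rw [Walk.mem_support_iff] at hx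
  exact hx.resolve_left hne

end IsPathSupport

namespace TopMinorEmbedding

variable {V W : Type*} {G : SimpleGraph V} {H : SimpleGraph W} (e : TopMinorEmbedding H G)

/-- The vertices of the model that represent the subgraph of `H` induced by `S`. -/
def realize (S : Set W) : Set V :=
  {x | (∃ a ∈ S, x = e.φ a) ∨
    ∃ (a b : W) (h : H.Adj a b), a ∈ S ∧ b ∈ S ∧ x ∈ (e.path h).support}

theorem mem_of_apply_mem_realize {S : Set W} {c : W} (h : e.φ c ∈ e.realize S) : c ∈ S := by
  obtain ⟨a, ha, hca⟩ | ⟨a, b, hab, ha, hb, hc⟩ := h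
  · exact e.inj hca ▸ ha
  · obtain rfl | rfl := e.branchOnPath hab c hc <;> assumption

theorem joinedWithin_realize {S : Set W} {a b : W} (h : JoinedWithin H S a b) :
    JoinedWithin G (e.realize S) (e.φ a) (e.φ b) := by
  obtain ⟨p, hp⟩ := h
  induction p with
  | @nil u =>
    refine ⟨.nil, fun x hx => .inl ⟨u, hp u (Walk.start_mem_support _), by simpa using hx⟩⟩
  | @cons u v _ huv p ih =>
    obtain ⟨q, hq⟩ := ih fun x hx => hp x (by simp [hx])
    refine ⟨(e.path huv).append q, fun x hx => ?_⟩
    rw [Walk.mem_support_append_iff] at hx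
    exact hx.elim
      (fun hx => .inr ⟨u, v, huv, hp u (by simp), hp v (by simp), hx⟩) (hq x)

theorem realize_inter_subset {S T : Set W} (hST : (S ∩ T).Subsingleton) :
    e.realize S ∩ e.realize T ⊆ e.φ '' (S ∩ T) := by
  rintro x ⟨hS, hT⟩
  suffices H : ∃ c, x = e.φ c by
    obtain ⟨c, rfl⟩ := H
    exact ⟨c, ⟨e.mem_of_apply_mem_realize hS, e.mem_of_apply_mem_realize hT⟩, rfl⟩
  obtain ⟨a, -, rfl⟩ | ⟨a, b, hab, ha, hb, hx⟩ := hS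
  · exact ⟨a, rfl⟩
  obtain ⟨c, -, rfl⟩ | ⟨c, d, hcd, hc, hd, hx'⟩ := hT
  · exact ⟨c, rfl⟩
  have hne : s(a, b) ≠ s(c, d) := by
    intro h
    apply hab.ne
    rcases Sym2.eq_iff.1 h with ⟨rfl, rfl⟩ | ⟨rfl, rfl⟩
    · exact hST ⟨ha, hc⟩ ⟨hb, hd⟩
    · exact hST ⟨ha, hd⟩ ⟨hb, hc⟩
  rcases (e.disj hab hcd hne ⟨hx, hx'⟩).1 with h | h
  · exact ⟨a, h⟩
  · exact ⟨b, h⟩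

/-- A fan whose spokes and segments are given by vertex sets in `H` is realized
by a fan subdivision in `G`. -/
theorem nonempty_fanSubdivision {k : ℕ} {v : W} {b : Fin k → W} (hb : Function.Injective b)
    (hbv : ∀ i, b i ≠ v) (S T : Fin k → Set W)
    (hS : ∀ i, JoinedWithin H (S i) v (b i))
    (hT : ∀ (i : Fin k) (h : (i : ℕ) + 1 < k), JoinedWithin H (T i) (b i) (b ⟨i + 1, h⟩))
    (hvT : ∀ i, v ∉ T i)
    (hSS : ∀ i j, i ≠ j → S i ∩ S j ⊆ {v})
    (hST : ∀ (i j : Fin k) (h : (j : ℕ) + 1 < k),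
      S i ∩ T j ⊆ ({b i} : Set W) ∩ {b j, b ⟨j + 1, h⟩})
    (hTT : ∀ (i j : Fin k) (hi : (i : ℕ) + 1 < k) (hj : (j : ℕ) + 1 < k), i ≠ j →
      T i ∩ T j ⊆ ({b i, b ⟨i + 1, hi⟩} : Set W) ∩ {b j, b ⟨j + 1, hj⟩}) :
    Nonempty (FanSubdivision G (e.φ v) k) := by
  choose P hP hPS using fun i => (e.joinedWithin_realize (hS i)).exists_isPath
  choose Q hQ hQT using fun i h => (e.joinedWithin_realize (hT i h)).exists_isPath
  refine ⟨⟨fun i => e.φ (b i), e.inj.comp hb, fun i h => hbv i (e.inj h), P, hP, Q, hQ,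
    fun i h hv => hvT i (e.mem_of_apply_mem_realize (hQT i h _ hv)), ?_, ?_, ?_⟩⟩
  · intro i j hij
    apply Set.Subset.antisymm
    · rintro x ⟨hxi, hxj⟩
      obtain ⟨c, hc, rfl⟩ := e.realize_inter_subset
        (Set.subsingleton_singleton.anti (hSS i j hij)) ⟨hPS i x hxi, hPS j x hxj⟩
      rw [hSS i j hij hc]
      rfl
    · rintro x rfl
      exact ⟨Walk.start_mem_support _, Walk.start_mem_support _⟩
  · rintro i j h x ⟨hxi, hxj⟩
    obtain ⟨c, hc, rfl⟩ := e.realize_inter_subset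
      (Set.subsingleton_singleton.anti ((hST i j h).trans Set.inter_subset_left))
      ⟨hPS i x hxi, hQT j h x hxj⟩
    obtain ⟨h1, h2⟩ := hST i j h hc
    exact ⟨congrArg e.φ h1, h2.imp (congrArg e.φ) (congrArg e.φ)⟩
  · rintro i j hi hj hij x ⟨hxi, hxj⟩
    have hsub : (T i ∩ T j).Subsingleton := by
      intro c hc d hd
      obtain ⟨hci, hcj⟩ := hTT i j hi hj hij hc
      obtain ⟨hdi, hdj⟩ := hTT i j hi hj hij hd
      simp only [Set.mem_insert_iff, Set.mem_singleton_iff] at hci hcj hdi hdj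
      have hij' : (i : ℕ) ≠ j := fun h => hij (Fin.ext h)
      rcases hci with rfl | rfl <;> rcases hdi with rfl | rfl <;>
        simp only [hb.eq_iff, Fin.ext_iff] at * <;> omega
    obtain ⟨c, hc, rfl⟩ := e.realize_inter_subset hsub ⟨hQT i hi x hxi, hQT j hj x hxj⟩
    obtain ⟨h1, h2⟩ := hTT i j hi hj hij hc
    exact ⟨h1.imp (congrArg e.φ) (congrArg e.φ), h2.imp (congrArg e.φ) (congrArg e.φ)⟩

end TopMinorEmbedding

/-- Two disjoint pairs of paths from neighbours of `w`, the first pair meeting in `r` and the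
second in `c`, together with a path from `r` to `c`, yield a gem centred at `w`, provided that
the first path of each pair is nontrivial. -/
theorem TopMinorEmbedding.gem_of_two_branchings_of_ne {V W : Type*} {G : SimpleGraph V}
    {H : SimpleGraph W} (e : TopMinorEmbedding H G) {w c r x₁ x₂ y₁ y₂ : W}
    {M A₁ A₂ B₁ B₂ : Set W}
    (hx₁ : H.Adj w x₁) (hx₂ : H.Adj w x₂) (hy₁ : H.Adj w y₁) (hy₂ : H.Adj w y₂)
    (hM : IsPathSupport H M r c)
    (hA₁ : IsPathSupport H A₁ x₁ r) (hA₂ : IsPathSupport H A₂ x₂ r)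
    (hB₁ : IsPathSupport H B₁ y₁ c) (hB₂ : IsPathSupport H B₂ y₂ c)
    (hwM : w ∉ M) (hwA₁ : w ∉ A₁) (hwB₁ : w ∉ B₁)
    (hA : A₁ ∩ A₂ ⊆ {r}) (hB : B₁ ∩ B₂ ⊆ {c})
    (hAM : (A₁ ∪ A₂) ∩ M ⊆ {r}) (hBM : (B₁ ∪ B₂) ∩ M ⊆ {c})
    (hAB : Disjoint (A₁ ∪ A₂) (B₁ ∪ B₂)) (hxr : x₁ ≠ r) (hyc : y₁ ≠ c) :
    Nonempty (FanSubdivision G (e.φ w) 4) := by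
  have hAB' : ∀ z, z ∈ A₁ ∪ A₂ → z ∉ B₁ ∪ B₂ := fun z h h' => Set.disjoint_left.1 hAB h h'
  have hx₁A := hA₁.left_mem
  have hrA := hA₁.right_mem
  have hy₁B := hB₁.left_mem
  have hcB := hB₁.right_mem
  have hrM := hM.left_mem
  have hcM := hM.right_mem
  simp only [Set.subset_def, Set.mem_inter_iff, Set.mem_union, Set.mem_singleton_iff]
    at hA hB hAM hBM hAB'
  have edge : ∀ {x}, H.Adj w x → JoinedWithin H {w, x} w x := fun h =>
    (IsPathSupport.refl _).joinedWithin.cons h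
  refine e.nonempty_fanSubdivision (b := ![x₁, r, c, y₁]) ?_ ?_
    ![{w, x₁}, insert w A₂, insert w B₂, {w, y₁}] ![A₁, M, B₁, ∅] ?_ ?_ ?_ ?_ ?_ ?_
  · intro i j hij
    fin_cases i <;> fin_cases j <;> simp at hij ⊢ <;> grind
  · intro i
    fin_cases i <;> simp <;> grind
  · intro i
    fin_cases i
    · exact edge hx₁
    · exact hA₂.joinedWithin.cons hx₂
    · exact hB₂.joinedWithin.cons hy₂
    · exact edge hy₁
  · intro i h
    fin_cases i
    · exact hA₁.joinedWithin
    · exact hM.joinedWithin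
    · exact hB₁.symm.joinedWithin
    · simp at h
  · intro i
    fin_cases i <;> simp <;> grind
  · intro i j hij z hz
    fin_cases i <;> fin_cases j <;> simp at hij hz ⊢ <;> grind
  · intro i j h z hz
    fin_cases i <;> fin_cases j <;> simp at h hz ⊢ <;> grind
  · intro i j hi hj hij z hz
    fin_cases i <;> fin_cases j <;> simp at hi hj hij hz ⊢ <;> grind

/-- The nontriviality assumption of `gem_of_two_branchings_of_ne` can be met by
exchanging the two paths of a pair. -/
theorem TopMinorEmbedding.gem_of_two_branchings {V W : Type*} {G : SimpleGraph V}
    {H : SimpleGraph W} (e : TopMinorEmbedding H G) {w c r x₁ x₂ y₁ y₂ : W}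
    {M A₁ A₂ B₁ B₂ : Set W}
    (hx₁ : H.Adj w x₁) (hx₂ : H.Adj w x₂) (hy₁ : H.Adj w y₁) (hy₂ : H.Adj w y₂)
    (hM : IsPathSupport H M r c)
    (hA₁ : IsPathSupport H A₁ x₁ r) (hA₂ : IsPathSupport H A₂ x₂ r)
    (hB₁ : IsPathSupport H B₁ y₁ c) (hB₂ : IsPathSupport H B₂ y₂ c)
    (hwM : w ∉ M) (hwA : w ∉ A₁ ∪ A₂) (hwB : w ∉ B₁ ∪ B₂)
    (hA : A₁ ∩ A₂ ⊆ {r}) (hB : B₁ ∩ B₂ ⊆ {c})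
    (hAM : (A₁ ∪ A₂) ∩ M ⊆ {r}) (hBM : (B₁ ∪ B₂) ∩ M ⊆ {c})
    (hAB : Disjoint (A₁ ∪ A₂) (B₁ ∪ B₂)) (hx : x₁ ≠ x₂) (hy : y₁ ≠ y₂) :
    Nonempty (FanSubdivision G (e.φ w) 4) := by
  wlog hxr : x₁ ≠ r generalizing x₁ x₂ A₁ A₂
  · rw [Set.union_comm] at hwA hAM hAB
    rw [Set.inter_comm] at hA
    exact this hx₂ hx₁ hA₂ hA₁ hwA hA hAM hAB hx.symm (by grind)
  wlog hyc : y₁ ≠ c generalizing y₁ y₂ B₁ B₂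
  · rw [Set.union_comm] at hwB hBM
    rw [Set.union_comm B₁] at hAB
    rw [Set.inter_comm] at hB
    exact this hy₂ hy₁ hB₂ hB₁ hwB hB hBM hy.symm hAB (by grind)
  exact e.gem_of_two_branchings_of_ne hx₁ hx₂ hy₁ hy₂ hM hA₁ hA₂ hB₁ hB₂ hwM
    (fun h => hwA (.inl h)) (fun h => hwB (.inl h)) hA hB hAM hBM hAB hxr hyc

/-- A spider with centre `c` and three leaves among the neighbours of `w`, together with a path
from a fourth neighbour that reaches the spider on its first leg, yields a gem. -/
theorem TopMinorEmbedding.gem_of_spider_of_path {V W : Type*} {G : SimpleGraph V}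
    {H : SimpleGraph W} (e : TopMinorEmbedding H G) {w c r x₁ x₂ x₃ y : W}
    {L₁ L₂ L₃ Q : Set W}
    (hx₁ : H.Adj w x₁) (hx₂ : H.Adj w x₂) (hx₃ : H.Adj w x₃) (hy : H.Adj w y)
    (h₂₃ : x₂ ≠ x₃) (hy₁ : y ≠ x₁)
    (hL₁ : IsPathSupport H L₁ x₁ c) (hL₂ : IsPathSupport H L₂ x₂ c)
    (hL₃ : IsPathSupport H L₃ x₃ c) (hQ : IsPathSupport H Q y r)
    (hw : w ∉ L₁ ∪ L₂ ∪ L₃ ∪ Q) (hcQ : c ∉ Q)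
    (hL₁₂ : L₁ ∩ L₂ ⊆ {c}) (hL₁₃ : L₁ ∩ L₃ ⊆ {c}) (hL₂₃ : L₂ ∩ L₃ ⊆ {c})
    (hr : r ∈ L₁) (hQL : Q ∩ (L₁ ∪ L₂ ∪ L₃) ⊆ {r}) :
    Nonempty (FanSubdivision G (e.φ w) 4) := by
  obtain ⟨A, M, hA, hM, hAL, hML, hAM⟩ := hL₁.split hr
  have hrQ := hQ.right_mem
  have hcM := hM.right_mem
  simp only [Set.subset_def, Set.mem_inter_iff, Set.mem_union, Set.mem_singleton_iff]
    at hAL hML hAM hL₁₂ hL₁₃ hL₂₃ hQL hw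
  refine e.gem_of_two_branchings hy hx₁ hx₂ hx₃ hM hQ hA hL₂ hL₃ ?_ ?_ ?_ ?_ ?_ ?_ ?_ ?_ hy₁ h₂₃
  on_goal 8 => rw [Set.disjoint_left]
  all_goals grind

/-- Any three vertices of a connected set `D` are joined inside `D` by a spider. -/
theorem exists_spider {W : Type*} {H : SimpleGraph W} {D : Set W}
    (hD : (H.induce D).Preconnected) {x₁ x₂ x₃ : W} (hx₁ : x₁ ∈ D) (hx₂ : x₂ ∈ D)
    (hx₃ : x₃ ∈ D) :
    ∃ c L₁ L₂ L₃, IsPathSupport H L₁ x₁ c ∧ IsPathSupport H L₂ x₂ c ∧ IsPathSupport H L₃ x₃ c ∧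
      L₁ ⊆ D ∧ L₂ ⊆ D ∧ L₃ ⊆ D ∧ L₁ ∩ L₂ ⊆ {c} ∧ L₁ ∩ L₃ ⊆ {c} ∧ L₂ ∩ L₃ ⊆ {c} := by
  obtain ⟨p, hp, hpD⟩ := (JoinedWithin.of_induce hx₁ hx₂ hD).exists_isPath
  have hP : IsPathSupport H {x | x ∈ p.support} x₁ x₂ := ⟨p, hp, rfl⟩
  obtain ⟨c, hc, Q, hQD, hQ, hQP⟩ :=
    (JoinedWithin.of_induce hx₃ hx₁ hD).exists_first_hit hP.left_mem
  obtain ⟨A, B, hA, hB, hAP, hBP, hAB⟩ := hP.split hc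
  exact ⟨c, A, B, Q, hA, hB.symm, hQ, hAP.trans hpD, hBP.trans hpD, hQD, hAB,
    fun x hx => hQP ⟨hx.2, hAP hx.1⟩, fun x hx => hQP ⟨hx.2, hBP hx.1⟩⟩

/-- A spider in `H - w` whose three leaves are neighbours of `w` yields a gem as soon as `w` has
a fourth neighbour different from the centre of the spider. -/
theorem TopMinorEmbedding.gem_of_spider {V W : Type*} {G : SimpleGraph V}
    {H : SimpleGraph W} (e : TopMinorEmbedding H G) (hH : ThreeConnected H)
    {w c x₁ x₂ x₃ y : W} {L₁ L₂ L₃ : Set W}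
    (hx₁ : H.Adj w x₁) (hx₂ : H.Adj w x₂) (hx₃ : H.Adj w x₃) (hy : H.Adj w y)
    (h₁₂ : x₁ ≠ x₂) (h₁₃ : x₁ ≠ x₃) (h₂₃ : x₂ ≠ x₃)
    (hy₁ : y ≠ x₁) (hy₂ : y ≠ x₂) (hy₃ : y ≠ x₃) (hyc : y ≠ c)
    (hL₁ : IsPathSupport H L₁ x₁ c) (hL₂ : IsPathSupport H L₂ x₂ c)
    (hL₃ : IsPathSupport H L₃ x₃ c) (hw₁ : w ∉ L₁) (hw₂ : w ∉ L₂) (hw₃ : w ∉ L₃)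
    (hL₁₂ : L₁ ∩ L₂ ⊆ {c}) (hL₁₃ : L₁ ∩ L₃ ⊆ {c}) (hL₂₃ : L₂ ∩ L₃ ⊆ {c}) :
    Nonempty (FanSubdivision G (e.φ w) 4) := by
  obtain ⟨z, hzL, hzw, hzc⟩ : ∃ z, z ∈ L₁ ∪ L₂ ∪ L₃ ∧ z ≠ w ∧ z ≠ c := by
    by_cases h : x₁ = c
    · exact ⟨x₂, .inl (.inr hL₂.left_mem), hx₂.ne', fun h' => h₁₂ (h.trans h'.symm)⟩
    · exact ⟨x₁, .inl (.inl hL₁.left_mem), hx₁.ne', h⟩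
  obtain ⟨r, ⟨hr, hrc⟩, Q, hQD, hQ, hQK⟩ :=
    (JoinedWithin.of_induce (S := {v | v ≠ w ∧ v ≠ c}) ⟨hy.ne', hyc⟩ ⟨hzw, hzc⟩
      (hH.2 w c).preconnected).exists_first_hit (K := (L₁ ∪ L₂ ∪ L₃) \ {c}) ⟨hzL, hzc⟩
  have hcQ : c ∉ Q := fun h => (hQD h).2 rfl
  have hwQ : w ∉ Q := fun h => (hQD h).1 rfl
  have hQL : ∀ v ∈ Q, v ∈ L₁ ∪ L₂ ∪ L₃ → v = r := fun v hv hvL =>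
    hQK ⟨hv, hvL, fun h => hcQ (h ▸ hv)⟩
  simp only [Set.mem_union] at hr hQL
  obtain (hr | hr) | hr := hr
  · exact e.gem_of_spider_of_path hx₁ hx₂ hx₃ hy h₂₃ hy₁ hL₁ hL₂ hL₃ hQ (by grind) hcQ
      hL₁₂ hL₁₃ hL₂₃ hr (by grind)
  · exact e.gem_of_spider_of_path hx₂ hx₁ hx₃ hy h₁₃ hy₂ hL₂ hL₁ hL₃ hQ (by grind) hcQ
      (by grind) hL₂₃ hL₁₃ hr (by grind)
  · exact e.gem_of_spider_of_path hx₃ hx₁ hx₂ hy h₁₂ hy₃ hL₃ hL₁ hL₂ hQ (by grind) hcQ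
      (by grind) (by grind) hL₁₂ hr (by grind)

/-- reduction form: if a 3-connected graph `H` with a vertex of degree at
least `4` is a topological minor of `G`, then `G` contains a subdivision of the gem `F₄`. -/
theorem gem_of_topMinor_threeConnected_degree_four {V W : Type*} (G : SimpleGraph V)
    (H : SimpleGraph W) (hH3 : ThreeConnected H) (e : TopMinorEmbedding H G)
    (w : W) (hw : 4 ≤ {x : W | H.Adj w x}.ncard) :
    ∃ v : V, Nonempty (FanSubdivision G v 4) := by
  have hfin : {x : W | H.Adj w x}.Finite := Set.finite_of_ncard_pos (by omega)
  have := hfin.fintype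
  obtain ⟨f⟩ : Nonempty (Fin 4 ↪ {x : W | H.Adj w x}) := by
    apply Function.Embedding.nonempty_of_card_le
    rwa [Fintype.card_fin, ← Nat.card_eq_fintype_card]
  have hadj : ∀ i, H.Adj w (f i) := fun i => (f i).2
  have hne : ∀ i j, i ≠ j → (f i : W) ≠ f j := fun i j hij h =>
    hij (f.injective (Subtype.ext h))
  have hmem : ∀ i, (f i : W) ∈ {v : W | v ≠ w ∧ v ≠ w} := fun i =>
    ⟨(hadj i).ne', (hadj i).ne'⟩
  obtain ⟨c, L₁, L₂, L₃, hL₁, hL₂, hL₃, hD₁, hD₂, hD₃, h₁₂, h₁₃, h₂₃⟩ :=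
    exists_spider (hH3.2 w w).preconnected (hmem 0) (hmem 1) (hmem 2)
  have hw₁ : w ∉ L₁ := fun h => (hD₁ h).1 rfl
  have hw₂ : w ∉ L₂ := fun h => (hD₂ h).1 rfl
  have hw₃ : w ∉ L₃ := fun h => (hD₃ h).1 rfl
  refine ⟨e.φ w, ?_⟩
  by_cases hc : (f 3 : W) = c
  · subst hc
    exact e.gem_of_spider hH3 (hadj 0) (hadj 1) (hadj 3) (hadj 2)
      (hne _ _ (by decide)) (hne _ _ (by decide)) (hne _ _ (by decide)) (hne _ _ (by decide))
      (hne _ _ (by decide)) (hne _ _ (by decide)) (hne _ _ (by decide))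
      hL₁ hL₂ (IsPathSupport.refl _) hw₁ hw₂ (hadj 3).ne
      h₁₂ Set.inter_subset_right Set.inter_subset_right
  · exact e.gem_of_spider hH3 (hadj 0) (hadj 1) (hadj 2) (hadj 3)
      (hne _ _ (by decide)) (hne _ _ (by decide)) (hne _ _ (by decide)) (hne _ _ (by decide))
      (hne _ _ (by decide)) (hne _ _ (by decide)) hc
      hL₁ hL₂ hL₃ hw₁ hw₂ hw₃ h₁₂ h₁₃ h₂₃
end
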